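/- (Local truncation error of sLRI1.) Let 0 ≤ r < 1 and suppose the mild solution satisfies U ∈ L^∞(0,T; H^{1+r}(𝕋) × H^r(𝕋)). Define the one-step defect 𝓡_τ(t_n) := U(t_{n+1}) − e^{2τL} U(t_{n−1}) − 2τ e^{τL} F(U(t_n)). Then ||𝓡_τ(t_n)||₁ ≤ C ( sup_t ||U(·,t)||_{1+r} ) τ^{2+r}, where C is independent of τ and n. -/

import Mathlib

open MeasureTheory Real Set

namespace KG

/-- Points of the `d`-dimensional torus `𝕋^d`, modeled by `ℝ^d` together with
`1`-periodic functions. -/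
abbrev Pt (d : ℕ) := Fin d → ℝ

/-- Real-valued fields on the torus. -/
abbrev Fn (d : ℕ) := Pt d → ℝ

/-- A pair `U = (u, ∂ₜ u)`. -/
abbrev Pair (d : ℕ) := Fn d × Fn d

/-- A fundamental domain of the torus. -/
def box (d : ℕ) : Set (Pt d) := Set.univ.pi fun _ => Set.Ico (0:ℝ) 1

/-- `1`-periodicity in each coordinate direction. -/
def Per {d : ℕ} (u : Fn d) : Prop := ∀ x i, u (x + Pi.single i 1) = u x

/-- The character `e^{2π i k·x}` of the torus. -/
noncomputable def ch {d : ℕ} (k : Fin d → ℤ) (x : Pt d) : ℂ :=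
  Complex.exp (2 * (Real.pi : ℂ) * Complex.I * ∑ i, (k i : ℂ) * (x i : ℂ))

/-- The `k`-th Fourier coefficient of `u`. -/
noncomputable def fc {d : ℕ} (u : Fn d) (k : Fin d → ℤ) : ℂ :=
  ∫ x in box d, (u x : ℂ) * ch (-k) x

/-- `|k|`. -/
noncomputable def freq {d : ℕ} (k : Fin d → ℤ) : ℝ := Real.sqrt (∑ i, ((k i : ℝ))^2)

/-- The bracket `⟨k⟩ = max(|k|, 1)`. -/
noncomputable def jb {d : ℕ} (k : Fin d → ℤ) : ℝ := max (freq k) 1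

/-- The (inhomogeneous) Sobolev norm `‖u‖_{H^α(𝕋^d)}`, defined on the Fourier side. -/
noncomputable def sob {d : ℕ} (α : ℝ) (u : Fn d) : ℝ :=
  Real.sqrt (∑' k : Fin d → ℤ, jb k ^ (2*α) * ‖fc u k‖^2)

/-- The homogeneous Sobolev norm `‖u‖_{Ḣ^α(𝕋^d)}`. -/
noncomputable def hsob {d : ℕ} (α : ℝ) (u : Fn d) : ℝ :=
  Real.sqrt (∑' k : Fin d → ℤ, freq k ^ (2*α) * ‖fc u k‖^2)

/-- Membership `u ∈ H^α(𝕋^d)`. -/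
def MemSob {d : ℕ} (α : ℝ) (u : Fn d) : Prop :=
  Summable fun k : Fin d → ℤ => jb k ^ (2*α) * ‖fc u k‖^2

/-- The norm `‖W‖_α = (‖w₁‖²_{H^α} + ‖w₂‖²_{H^{α-1}})^{1/2}` of a pair. -/
noncomputable def pnorm {d : ℕ} (α : ℝ) (U : Pair d) : ℝ :=
  Real.sqrt (sob α U.1 ^ 2 + sob (α-1) U.2 ^ 2)

/-- The energy-type norm `|W|_α = (‖w₁‖²_{Ḣ^α} + ‖w₂‖²_{H^{α-1}})^{1/2}` of a pair. -/
noncomputable def penorm {d : ℕ} (α : ℝ) (U : Pair d) : ℝ :=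
  Real.sqrt (hsob α U.1 ^ 2 + sob (α-1) U.2 ^ 2)

/-- Membership `W ∈ H^α(𝕋^d) × H^{α-1}(𝕋^d)`. -/
def PMem {d : ℕ} (α : ℝ) (U : Pair d) : Prop := MemSob α U.1 ∧ MemSob (α-1) U.2

/-- The frequency `ω_k = 2π|k|` of the wave operator on the `k`-th mode. -/
noncomputable def omg {d : ℕ} (k : Fin d → ℤ) : ℝ := 2 * Real.pi * freq k

/-- `sin(ωt)/ω`, extended by its limit `t` at `ω = 0`. -/
noncomputable def snc (ω t : ℝ) : ℝ := if ω = 0 then t else Real.sin (ω * t) / ω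

/-- The group `e^{tL}`, `L = [[0,I],[Δ,0]]`, acting modewise by
`[[cos(ω_k t), sin(ω_k t)/ω_k], [-ω_k sin(ω_k t), cos(ω_k t)]]`. -/
noncomputable def expL {d : ℕ} (t : ℝ) (U : Pair d) : Pair d :=
  (fun x => (∑' k : Fin d → ℤ,
      ((Real.cos (omg k * t) : ℂ) * fc U.1 k + ((snc (omg k) t : ℝ) : ℂ) * fc U.2 k)
        * ch k x).re,
   fun x => (∑' k : Fin d → ℤ,
      (((-(omg k) * Real.sin (omg k * t) : ℝ) : ℂ) * fc U.1 k
        + (Real.cos (omg k * t) : ℂ) * fc U.2 k) * ch k x).re)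

/-- The nonlinearity `F(U) = (0, f(u))ᵀ`. -/
def Fnl {d : ℕ} (f : ℝ → ℝ) (U : Pair d) : Pair d :=
  (fun _ => 0, fun x => f (U.1 x))

/-- `H(U) = (-f(u), f'(u) v)ᵀ`. -/
noncomputable def Hnl {d : ℕ} (f : ℝ → ℝ) (U : Pair d) : Pair d :=
  (fun x => -(f (U.1 x)), fun x => deriv f (U.1 x) * U.2 x)

/-- Componentwise (pointwise) integral of a `Pair`-valued map. -/
noncomputable def pInt {d : ℕ} (a b : ℝ) (G : ℝ → Pair d) : Pair d :=
  (fun x => ∫ s in a..b, (G s).1 x, fun x => ∫ s in a..b, (G s).2 x)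

/-- Mild (energy) solution: the variation-of-constants (Duhamel) formula. -/
def IsMild {d : ℕ} (f : ℝ → ℝ) (T : ℝ) (U : ℝ → Pair d) : Prop :=
  ∀ t s : ℝ, 0 ≤ t → 0 ≤ s → t + s ≤ T →
    U (t + s) = expL s (U t) + pInt 0 s fun σ => expL (s - σ) (Fnl f (U (t + σ)))

/-- `τ² e^{τL} φ₂(-2τL) W = ∫₀^τ (τ-s) e^{(τ-2s)L} W ds`, where
`φ₂(A) = A⁻²(e^A - A - I)`. -/
noncomputable def corrNeg {d : ℕ} (τ : ℝ) (W : Pair d) : Pair d :=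
  pInt 0 τ fun s => (τ - s) • expL (τ - 2*s) W

/-- `τ² e^{τL} φ₂(2τL) W = ∫₀^τ (τ-s) e^{(τ+2s)L} W ds`. -/
noncomputable def corrPos {d : ℕ} (τ : ℝ) (W : Pair d) : Pair d :=
  pInt 0 τ fun s => (τ - s) • expL (τ + 2*s) W

/-- The product norm `|||(V₁,V₂)|||_α = (‖V₁‖_α² + ‖V₂‖_α²)^{1/2}`. -/
noncomputable def tnorm {d : ℕ} (α : ℝ) (UU : Pair d × Pair d) : ℝ :=
  Real.sqrt (pnorm α UU.1 ^ 2 + pnorm α UU.2 ^ 2)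

noncomputable def ee (k : ℤ) (x : ℝ) : ℂ := Complex.exp (2 * (Real.pi : ℂ) * Complex.I * ((k:ℂ) * (x:ℂ)))

lemma ee_add (k : ℤ) (x y : ℝ) : ee k (x + y) = ee k x * ee k y := by
  unfold ee; rw [← Complex.exp_add]; congr 1; push_cast; ring

lemma ee_zero (k : ℤ) : ee k 0 = 1 := by simp [ee]

lemma ee_eq (k : ℤ) (x : ℝ) : ee k x = Complex.exp (((2 * Real.pi * k * x : ℝ) : ℂ) * Complex.I) := by
  unfold ee; congr 1; push_cast; ring

lemma ee_neg (k : ℤ) (x : ℝ) : ee (-k) x = ee k (-x) := by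
  unfold ee; congr 1; push_cast; ring

lemma norm_ee (k : ℤ) (x : ℝ) : ‖ee k x‖ = 1 := by
  rw [ee_eq, Complex.norm_exp_ofReal_mul_I]

lemma ee_cont (k : ℤ) : Continuous (ee k) := by unfold ee; fun_prop

lemma ee_one (k : ℤ) : ee k 1 = 1 := by
  unfold ee
  rw [Complex.exp_eq_one_iff]; exact ⟨k, by push_cast; ring⟩

lemma ee_periodic (k : ℤ) : Function.Periodic (ee k) 1 := by
  intro x; rw [ee_add, ee_one, mul_one]

noncomputable def co (φ : ℝ → ℝ) (k : ℤ) : ℂ := ∫ x in (0:ℝ)..1, (φ x : ℂ) * ee (-k) x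

lemma ee_fourier (k : ℤ) (x : ℝ) : fourier k (x : AddCircle (1 - 0 : ℝ)) = ee k x := by
  rw [fourier_coe_apply]; unfold ee; congr 1; push_cast; ring

lemma ee_fourier' (k : ℤ) (x : ℝ) : fourier k (x : AddCircle (1 : ℝ)) = ee k x := by
  rw [fourier_coe_apply]; unfold ee; congr 1; push_cast; ring

lemma co_eq_on (φ : ℝ → ℝ) (k : ℤ) :
    co φ k = fourierCoeffOn (zero_lt_one' ℝ) (fun x => (φ x : ℂ)) k := by
  rw [fourierCoeffOn_eq_integral]
  simp only [ee_fourier, smul_eq_mul]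
  simp [co, mul_comm]

lemma parseval {φ : ℝ → ℝ} (h : Continuous φ) :
    HasSum (fun k => ‖co φ k‖ ^ 2) (∫ x in (0:ℝ)..1, φ x ^ 2) := by
  have hm : MemLp (fun x => (φ x : ℂ)) 2 (volume.restrict (Ioc (0:ℝ) 1)) := by
    have hc : Continuous (fun x => (φ x : ℂ)) := by fun_prop
    rw [memLp_two_iff_integrable_sq_norm hc.aestronglyMeasurable]
    have hc2 : Continuous (fun x => ‖(φ x : ℂ)‖ ^ 2) := by fun_prop
    exact (hc2.intervalIntegrable 0 1).1
  have := hasSum_sq_fourierCoeffOn (zero_lt_one' ℝ) hm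
  simp only [← co_eq_on] at this
  simpa using this

lemma series {φ : ℝ → ℝ} (h : Continuous φ) (hp : Function.Periodic φ 1) (hs : Summable (co φ))
    (x : ℝ) : HasSum (fun k => co φ k * ee k x) (φ x : ℂ) := by
  have : Fact ((0:ℝ) < 1) := ⟨zero_lt_one⟩
  have hp' : Function.Periodic (fun x => (φ x : ℂ)) 1 := fun x => by simp [hp x]
  have hc : Continuous hp'.lift := by
    refine continuous_coinduced_dom.mpr ?_
    have : Continuous (fun x => (φ x : ℂ)) := by fun_prop
    exact this
  let F : C(AddCircle (1:ℝ), ℂ) := ⟨hp'.lift, hc⟩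
  have hF : ∀ k, fourierCoeff F k = co φ k := by
    intro k
    rw [fourierCoeff_eq_intervalIntegral _ _ 0]
    simp only [ee_fourier', smul_eq_mul, co]
    simp only [zero_add, div_one, one_smul]
    refine intervalIntegral.integral_congr fun x _ => ?_
    have : F (x : AddCircle (1:ℝ)) = φ x := hp'.lift_coe x
    simp only [this]; ring
  have := has_pointwise_sum_fourier_series_of_summable (f := F) (by rw [funext hF]; exact hs) x
  simp only [hF, ee_fourier', smul_eq_mul] at this
  convert this using 1
  exact (hp'.lift_coe x).symm

lemma co_shift {φ : ℝ → ℝ} (hp : Function.Periodic φ 1) (h : ℝ) (k : ℤ) :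
    co (fun x => φ (x + h)) k = ee k h * co φ k := by
  unfold co
  rw [← intervalIntegral.integral_const_mul]
  have h1 : ∀ x, (φ (x+h) : ℂ) * ee (-k) x = (fun y => ee k h * ((φ y : ℂ) * ee (-k) y)) (x + h) := by
    intro x
    simp only [ee_add]
    rw [ee_neg k h]
    have : ee k h * ee k (-h) = 1 := by rw [← ee_add]; simp [ee_zero]
    linear_combination (- (φ (x+h) : ℂ) * ee (-k) x) * this
  simp only [h1]
  rw [intervalIntegral.integral_comp_add_right (fun y => ee k h * ((φ y : ℂ) * ee (-k) y))]
  have hper : Function.Periodic (fun y => ee k h * ((φ y : ℂ) * ee (-k) y)) 1 := by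
    intro y; simp only [hp y, ee_periodic (-k) y]
  have := hper.intervalIntegral_add_eq h 0
  simpa [add_comm] using this

lemma co_lin {φ ψ : ℝ → ℝ} (hφ : Continuous φ) (hψ : Continuous ψ) (a b : ℝ) (k : ℤ) :
    co (fun x => a * φ x + b * ψ x) k = a * co φ k + b * co ψ k := by
  unfold co
  rw [← intervalIntegral.integral_const_mul, ← intervalIntegral.integral_const_mul,
    ← intervalIntegral.integral_add]
  · refine intervalIntegral.integral_congr fun x _ => ?_
    push_cast; ring
  · have := ee_cont (-k)
    exact Continuous.intervalIntegrable (by fun_prop) _ _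
  · have := ee_cont (-k)
    exact Continuous.intervalIntegrable (by fun_prop) _ _

lemma swapc {F : ℝ → ℝ → ℂ} (hF : Continuous (Function.uncurry F)) (a b c d : ℝ) :
    ∫ x in a..b, ∫ y in c..d, F x y = ∫ y in c..d, ∫ x in a..b, F x y := by
  apply MeasureTheory.intervalIntegral_intervalIntegral_swap
  refine IntegrableOn.mono_set (t := (uIcc a b) ×ˢ (uIcc c d)) ?_ (prod_mono uIoc_subset_uIcc uIoc_subset_uIcc)
  exact (hF.continuousOn).integrableOn_compact (isCompact_uIcc.prod isCompact_uIcc)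

lemma swapr {F : ℝ → ℝ → ℝ} (hF : Continuous (Function.uncurry F)) (a b c d : ℝ) :
    ∫ x in a..b, ∫ y in c..d, F x y = ∫ y in c..d, ∫ x in a..b, F x y := by
  apply MeasureTheory.intervalIntegral_intervalIntegral_swap
  refine IntegrableOn.mono_set (t := (uIcc a b) ×ˢ (uIcc c d)) ?_ (prod_mono uIoc_subset_uIcc uIoc_subset_uIcc)
  exact (hF.continuousOn).integrableOn_compact (isCompact_uIcc.prod isCompact_uIcc)

lemma co_prim {φ : ℝ → ℝ} (hφ : Continuous φ) (hp : Function.Periodic φ 1) (a b : ℝ) (k : ℤ) :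
    co (fun x => ∫ z in a..b, φ (x + z)) k = (∫ z in a..b, ee k z) * co φ k := by
  have he := ee_cont (-k)
  have h1 : co (fun x => ∫ z in a..b, φ (x + z)) k
      = ∫ x in (0:ℝ)..1, ∫ z in a..b, (φ (x+z) : ℂ) * ee (-k) x := by
    unfold co
    refine intervalIntegral.integral_congr fun x _ => ?_
    simp only [← intervalIntegral.integral_ofReal, intervalIntegral.integral_mul_const]
  rw [h1, swapc (F := fun x z => (φ (x+z) : ℂ) * ee (-k) x)]
  · rw [← intervalIntegral.integral_mul_const]
    refine intervalIntegral.integral_congr fun z _ => ?_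
    exact co_shift hp z k
  · unfold Function.uncurry; fun_prop

lemma co_deriv {D P : ℝ → ℝ} (hD : ∀ x, HasDerivAt D (P x) x) (hP : Continuous P)
    (hp : Function.Periodic D 1) (k : ℤ) : 2 * Real.pi * |(k:ℝ)| * ‖co D k‖ = ‖co P k‖ ∨ k = 0 := by
  by_cases hk : k = 0
  · right; exact hk
  left
  have h1 := fourierCoeffOn_of_hasDerivAt (zero_lt_one' ℝ) (f := fun x => (D x : ℂ))
    (f' := fun x => (P x : ℂ)) (n := k) hk (fun x _ => (hD x).ofReal_comp)
    (Continuous.intervalIntegrable (by fun_prop) _ _)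
  rw [← co_eq_on, ← co_eq_on] at h1
  have h2 : D 1 = D 0 := by simpa using hp 0
  have hk' : (0:ℝ) < |(k:ℝ)| := abs_pos.mpr (by exact_mod_cast hk)
  rw [h1, h2]
  simp only [sub_self, mul_zero, zero_sub, norm_mul, norm_div, norm_neg, norm_one, Complex.norm_I,
    Complex.norm_real, Complex.norm_intCast, Complex.ofReal_one, Complex.ofReal_zero, sub_zero, one_mul, mul_one,
    Complex.norm_ofNat, Real.norm_eq_abs, abs_of_pos Real.pi_pos]
  field_simp

noncomputable def jj (k : ℤ) : ℝ := max |(k:ℝ)| 1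

lemma jj_one (k : ℤ) : 1 ≤ jj k := le_max_right _ _
lemma jj_pos (k : ℤ) : 0 < jj k := lt_of_lt_of_le one_pos (jj_one k)
lemma jj_ge (k : ℤ) : |(k:ℝ)| ≤ jj k := le_max_left _ _
lemma jj_zero : jj 0 = 1 := by simp [jj]
lemma jj_ne {k : ℤ} (hk : k ≠ 0) : jj k = |(k:ℝ)| := by
  unfold jj
  apply max_eq_left
  have : 1 ≤ |k| := Int.one_le_abs hk
  exact_mod_cast this

lemma ee_sub_one_le (k : ℤ) (h : ℝ) : ‖ee k h - 1‖ ≤ 2 * Real.pi * (jj k * |h|) := by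
  rw [ee_eq, mul_comm]
  refine (Real.norm_exp_I_mul_ofReal_sub_one_le).trans ?_
  rw [Real.norm_eq_abs, abs_mul, abs_mul, abs_of_pos Real.two_pi_pos]
  have := jj_ge k
  have h2 := Real.pi_pos
  rw [mul_assoc]
  gcongr

lemma ee_sub_one_le_two (k : ℤ) (h : ℝ) : ‖ee k h - 1‖ ≤ 2 := by
  refine (norm_sub_le _ _).trans ?_
  rw [norm_ee]; norm_num

lemma ee_bound (k : ℤ) (h : ℝ) {α : ℝ} (h0 : 0 ≤ α) (h1 : α ≤ 1) :
    ‖ee k h - 1‖ ≤ 4 * Real.pi * (jj k ^ α * |h| ^ α) := by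
  have hp := Real.pi_gt_three
  rw [← Real.mul_rpow (jj_pos k).le (abs_nonneg h)]
  have hn : 0 ≤ jj k * |h| := mul_nonneg (jj_pos k).le (abs_nonneg h)
  rcases le_total (jj k * |h|) 1 with hc | hc
  · have : jj k * |h| ≤ (jj k * |h|) ^ α := by
      rcases hn.eq_or_lt with h' | h'
      · rw [← h']; positivity
      · calc jj k * |h| = (jj k * |h|) ^ (1:ℝ) := by simp
          _ ≤ _ := Real.rpow_le_rpow_of_exponent_ge h' hc h1
    have h3 := ee_sub_one_le k h
    nlinarith
  · have : 1 ≤ (jj k * |h|) ^ α := Real.one_le_rpow hc h0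
    have h3 := ee_sub_one_le_two k h
    nlinarith

noncomputable def mm (k : ℤ) (h : ℝ) : ℂ := ∫ z in (0:ℝ)..h, ee k z

lemma mm_le (k : ℤ) (h : ℝ) : ‖mm k h‖ ≤ |h| := by
  have := intervalIntegral.norm_integral_le_of_norm_le_const (a := (0:ℝ)) (b := h) (f := ee k) (C := 1)
    (fun x _ => (norm_ee k x).le)
  simpa [mm] using this

lemma ee_deriv (k : ℤ) (x : ℝ) : HasDerivAt (fun x : ℝ => ee k x)
  ((2 * (Real.pi:ℂ) * Complex.I * k) * ee k x) x := by
  unfold ee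
  have h1 : HasDerivAt (fun y : ℂ => Complex.exp (2 * (Real.pi : ℂ) * Complex.I * ((k:ℂ) * y)))
    (Complex.exp (2 * (Real.pi : ℂ) * Complex.I * ((k:ℂ) * x)) * (2 * (Real.pi : ℂ) * Complex.I * ((k:ℂ) * 1))) (x:ℂ) :=
    ((((hasDerivAt_id (x:ℂ)).const_mul (k:ℂ)).const_mul _)).cexp
  convert h1.comp_ofReal using 1
  ring

lemma mm_mul (k : ℤ) (h : ℝ) : (2 * (Real.pi:ℂ) * Complex.I * k) * mm k h = ee k h - 1 := by
  have hd := ee_deriv k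
  have hc := ee_cont k
  have := intervalIntegral.integral_eq_sub_of_hasDerivAt (a := 0) (b := h) (fun x _ => hd x)
    (Continuous.intervalIntegrable (by fun_prop) _ _)
  rw [intervalIntegral.integral_const_mul, ee_zero] at this
  exact this

lemma mm_le' (k : ℤ) {h H : ℝ} (hH : |h| ≤ H) : ‖mm k h‖ ≤ (1 + H) * (jj k)⁻¹ := by
  have h0 : 0 ≤ H := (abs_nonneg h).trans hH
  by_cases hk : k = 0
  · subst hk; rw [jj_zero]; have := mm_le 0 h; simp; linarith
  · have h1 := congrArg norm (mm_mul k h)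
    simp only [norm_mul, Complex.norm_I, Complex.norm_real, Complex.norm_ofNat, Complex.norm_intCast,
      Real.norm_eq_abs, abs_of_pos Real.pi_pos, mul_one] at h1
    rw [← jj_ne hk] at h1
    have h2 := ee_sub_one_le_two k h
    have h3 := Real.pi_gt_three
    have h4 := jj_pos k
    rw [← div_eq_mul_inv, le_div_iff₀ h4]
    have h5 : 0 ≤ ‖mm k h‖ * jj k := by positivity
    nlinarith

lemma mm_bound (k : ℤ) {h H : ℝ} (hH : |h| ≤ H) {α : ℝ} (h0 : 0 ≤ α) (h1 : α ≤ 1) :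
    ‖mm k h‖ ≤ (1 + H) * (jj k ^ (α - 1) * |h| ^ α) := by
  have hH0 : 0 ≤ H := (abs_nonneg h).trans hH
  rcases (norm_nonneg (mm k h)).eq_or_lt with h' | h'
  · rw [← h']; have := jj_pos k; positivity
  calc ‖mm k h‖ = ‖mm k h‖ ^ α * ‖mm k h‖ ^ (1 - α) := by
        rw [← Real.rpow_add h']; simp
    _ ≤ |h| ^ α * ((1 + H) * (jj k)⁻¹) ^ (1 - α) := by
        have := mm_le k h
        have h2 := mm_le' k hH
        have h3 : 0 ≤ 1 - α := by linarith
        gcongr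
    _ = |h| ^ α * ((1 + H) ^ (1 - α) * jj k ^ (α - 1)) := by
        rw [Real.mul_rpow (by positivity) (inv_nonneg.mpr (jj_pos k).le), Real.inv_rpow (jj_pos k).le,
          ← Real.rpow_neg (jj_pos k).le]
        congr 3; ring
    _ ≤ |h| ^ α * ((1 + H) * jj k ^ (α - 1)) := by
        have : (1 + H) ^ (1 - α) ≤ 1 + H := by
          calc (1 + H) ^ (1 - α) ≤ (1+H) ^ (1:ℝ) := Real.rpow_le_rpow_of_exponent_le (by linarith) (by linarith)
            _ = _ := by simp
        have := jj_pos k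
        gcongr
    _ = _ := by ring

lemma _root_.HasSum.congr_fun' {f g : ℤ → ℂ} {a : ℂ} (h : HasSum g a) (e : ∀ k, f k = g k) : HasSum f a := by
  rw [funext e]; exact h

structure Nice (φ : ℝ → ℝ) : Prop where
  cont : Continuous φ
  per : Function.Periodic φ 1
  summ : Summable (co φ)

def HB (α : ℝ) (φ : ℝ → ℝ) (B : ℝ) : Prop :=
  Summable (fun k => jj k ^ (2 * α) * ‖co φ k‖ ^ 2) ∧ ∑' k, jj k ^ (2 * α) * ‖co φ k‖ ^ 2 ≤ B

noncomputable def ZZ : ℝ := ∑' k : ℤ, jj k ^ (-(3/2) : ℝ)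

lemma jj_summable : Summable (fun k : ℤ => jj k ^ (-(3/2) : ℝ)) := by
  have h := Real.summable_abs_int_rpow (b := 3/2) (by norm_num)
  refine Summable.congr_cofinite h ?_
  have : ∀ᶠ k : ℤ in Filter.cofinite, k ≠ 0 := Filter.eventually_cofinite_ne 0
  filter_upwards [this] with k hk
  rw [jj_ne hk]

lemma ZZ_nonneg : 0 ≤ ZZ := tsum_nonneg fun k => Real.rpow_nonneg (jj_pos k).le _

lemma HB.nonneg {α B : ℝ} {φ : ℝ → ℝ} (h : HB α φ B) : 0 ≤ B :=
  (tsum_nonneg fun k => by have := jj_pos k; positivity).trans h.2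

lemma l2mult {α B A : ℝ} {φ ψ : ℝ → ℝ} (h : HB α φ B) (hψ : Continuous ψ)
    (hm : ∀ k, ‖co ψ k‖ ≤ A * (jj k ^ α * ‖co φ k‖)) : ∫ x in (0:ℝ)..1, ψ x ^ 2 ≤ A ^ 2 * B := by
  rw [← (parseval hψ).tsum_eq]
  calc ∑' k, ‖co ψ k‖ ^ 2 ≤ ∑' k, A ^ 2 * (jj k ^ (2 * α) * ‖co φ k‖ ^ 2) := by
        refine (parseval hψ).summable.tsum_le_tsum ?_ (h.1.mul_left _)
        intro k
        calc ‖co ψ k‖ ^ 2 ≤ (A * (jj k ^ α * ‖co φ k‖)) ^ 2 := by gcongr; exact hm k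
          _ = _ := by
            rw [mul_comm 2 α, Real.rpow_mul (jj_pos k).le, Real.rpow_two]; ring
    _ = A ^ 2 * ∑' k, (jj k ^ (2 * α) * ‖co φ k‖ ^ 2) := tsum_mul_left
    _ ≤ _ := by have := h.2; gcongr

lemma amgm {α β : ℝ} (hβ : β ≤ α - 3/4) (k : ℤ) (c : ℝ) :
    jj k ^ β * c ≤ jj k ^ (-(3/2) : ℝ) + jj k ^ (2 * α) * c ^ 2 := by
  have hj := jj_pos k
  have h1 : jj k ^ β ≤ jj k ^ (-(3/4) : ℝ) * jj k ^ α := by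
    rw [← Real.rpow_add hj]
    exact Real.rpow_le_rpow_of_exponent_le (jj_one k) (by linarith)
  have h2 : jj k ^ (-(3/2) : ℝ) = (jj k ^ (-(3/4) : ℝ)) ^ 2 := by
    rw [← Real.rpow_two, ← Real.rpow_mul hj.le]; norm_num
  have h3 : jj k ^ (2 * α) = (jj k ^ α) ^ 2 := by
    rw [← Real.rpow_two, ← Real.rpow_mul hj.le]; ring_nf
  rw [h2, h3]
  have p1 : 0 < jj k ^ β := by positivity
  set a := jj k ^ (-(3/4) : ℝ)
  set b := jj k ^ α
  rcases le_total c 0 with hc | hc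
  · have : jj k ^ β * c ≤ 0 := mul_nonpos_of_nonneg_of_nonpos p1.le hc
    nlinarith [sq_nonneg a, sq_nonneg (b * c)]
  · have : jj k ^ β * c ≤ a * b * c := by gcongr
    nlinarith [sq_nonneg (a - b * c), sq_nonneg a, sq_nonneg (b * c)]

lemma summult {α β B A : ℝ} {φ ψ : ℝ → ℝ} (h : HB α φ B) (hβ : β ≤ α - 3/4) (hA : 0 ≤ A)
    (hm : ∀ k, ‖co ψ k‖ ≤ A * (jj k ^ β * ‖co φ k‖)) :
    Summable (fun k => ‖co ψ k‖) ∧ ∑' k, ‖co ψ k‖ ≤ A * (ZZ + B) := by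
  have hs := (jj_summable.add h.1).mul_left A
  have hle : ∀ k, ‖co ψ k‖ ≤ A * (jj k ^ (-(3/2) : ℝ) + jj k ^ (2 * α) * ‖co φ k‖ ^ 2) := fun k =>
    (hm k).trans (by gcongr; exact amgm hβ k _)
  have h1 := Summable.of_nonneg_of_le (fun k => norm_nonneg _) hle hs
  refine ⟨h1, (h1.tsum_le_tsum hle hs).trans ?_⟩
  rw [tsum_mul_left, jj_summable.tsum_add h.1]
  have := h.2
  unfold ZZ
  gcongr

lemma supmult {α β B A : ℝ} {φ ψ : ℝ → ℝ} (h : HB α φ B) (hβ : β ≤ α - 3/4) (hA : 0 ≤ A)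
    (hψ : Continuous ψ) (hp : Function.Periodic ψ 1)
    (hm : ∀ k, ‖co ψ k‖ ≤ A * (jj k ^ β * ‖co φ k‖)) (x : ℝ) : |ψ x| ≤ A * (ZZ + B) := by
  obtain ⟨h1, h2⟩ := summult h hβ hA hm
  have h3 := series hψ hp h1.of_norm x
  have : ‖(ψ x : ℂ)‖ ≤ ∑' k, ‖co ψ k‖ := by
    rw [← h3.tsum_eq]
    have e : ∀ k, ‖co ψ k * ee k x‖ = ‖co ψ k‖ := fun k => by rw [norm_mul, norm_ee, mul_one]
    refine (norm_tsum_le_tsum_norm (by simpa only [e] using h1)).trans ?_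
    simp only [e]; exact le_rfl
  rw [Complex.norm_real, Real.norm_eq_abs] at this
  exact this.trans h2

lemma HB.nice {α B : ℝ} {φ : ℝ → ℝ} (h : HB α φ B) (hα : 3/4 ≤ α) (hc : Continuous φ)
    (hp : Function.Periodic φ 1) : Nice φ :=
  ⟨hc, hp, (summult (β := 0) (A := 1) h (by linarith) zero_le_one (fun k => by simp)).1.of_norm⟩

lemma shift_cont {φ : ℝ → ℝ} (hc : Continuous φ) (h : ℝ) : Continuous (fun x => φ (x + h)) := by fun_prop

lemma co_diff {φ : ℝ → ℝ} (hc : Continuous φ) (hp : Function.Periodic φ 1) (h : ℝ) (k : ℤ) :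
    co (fun x => φ (x + h) - φ x) k = (ee k h - 1) * co φ k := by
  have h1 := co_lin (shift_cont hc h) hc 1 (-1) k
  rw [co_shift hp] at h1
  convert h1 using 2
  · ext x; ring
  · push_cast; ring

lemma per_shift {φ : ℝ → ℝ} (hp : Function.Periodic φ 1) (h : ℝ) : Function.Periodic (fun x => φ (x + h)) 1 := by
  intro x; simp only; rw [add_right_comm, hp]

lemma per_diff {φ : ℝ → ℝ} (hp : Function.Periodic φ 1) (h : ℝ) :
    Function.Periodic (fun x => φ (x + h) - φ x) 1 := by
  intro x; simp only; rw [hp x, add_right_comm, hp]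

lemma co_diff2 {φ : ℝ → ℝ} (hc : Continuous φ) (hp : Function.Periodic φ 1) (h : ℝ) (k : ℤ) :
    ‖co (fun x => φ (x + h) - 2 * φ x + φ (x - h)) k‖ = ‖ee k h - 1‖ * ‖ee k (-h) - 1‖ * ‖co φ k‖ := by
  have h1 := co_diff (φ := fun x => φ (x + h) - φ x) (by fun_prop) (per_diff hp h) (-h) k
  rw [co_diff hc hp] at h1
  have h2 : co (fun x => φ (x + h) - 2 * φ x + φ (x - h)) k
    = co (fun x => -1 * (φ (x + -h + h) - φ (x + -h) - (φ (x + h) - φ x)) + 0 * φ x) k := by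
    congr 1; ext x
    rw [show x + -h + h = x by ring, show x + -h = x - h by ring]; ring
  rw [h2, co_lin (by fun_prop) hc, h1]
  simp only [Complex.ofReal_neg, Complex.ofReal_one, Complex.ofReal_zero, zero_mul, add_zero, norm_mul, norm_neg, norm_one, one_mul]
  ring

/-- increments of a primitive -/
noncomputable def JJ (φ : ℝ → ℝ) (h x : ℝ) : ℝ := ∫ z in (0:ℝ)..h, φ (x + z)

lemma JJ_cont {φ : ℝ → ℝ} (hc : Continuous φ) (h : ℝ) : Continuous (JJ φ h) := by
  unfold JJ; fun_prop

lemma JJ_per {φ : ℝ → ℝ} (hp : Function.Periodic φ 1) (h : ℝ) : Function.Periodic (JJ φ h) 1 := by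
  intro x; unfold JJ
  refine intervalIntegral.integral_congr fun z _ => ?_
  rw [add_right_comm, hp]

lemma co_JJ {φ : ℝ → ℝ} (hc : Continuous φ) (hp : Function.Periodic φ 1) (h : ℝ) (k : ℤ) :
    co (JJ φ h) k = mm k h * co φ k := co_prim hc hp 0 h k

section ests
variable {φ : ℝ → ℝ} {r B : ℝ}

lemma diff_l2 (hc : Continuous φ) (hp : Function.Periodic φ 1) (hB : HB 1 φ B) (h : ℝ) :
    ∫ x in (0:ℝ)..1, (φ (x + h) - φ x) ^ 2 ≤ (2 * Real.pi * |h|) ^ 2 * B := by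
  refine l2mult hB (by fun_prop) fun k => ?_
  rw [co_diff hc hp, norm_mul, Real.rpow_one]
  calc _ ≤ (2 * Real.pi * (jj k * |h|)) * ‖co φ k‖ := by gcongr; exact ee_sub_one_le k h
    _ = _ := by ring

lemma diff_sup (hc : Continuous φ) (hp : Function.Periodic φ 1) (hB : HB (1 + r) φ B) {θ : ℝ} (h0 : 0 ≤ θ)
    (h1 : θ ≤ 1) (hθ : θ ≤ r + 1/4) (h x : ℝ) :
    |φ (x + h) - φ x| ≤ 4 * Real.pi * |h| ^ θ * (ZZ + B) := by
  refine supmult (β := θ) (ψ := fun x => φ (x + h) - φ x) hB (by linarith) (by positivity) (by fun_prop) (per_diff hp h) (fun k => ?_) x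
  rw [co_diff hc hp, norm_mul]
  calc _ ≤ (4 * Real.pi * (jj k ^ θ * |h| ^ θ)) * ‖co φ k‖ := by gcongr; exact ee_bound k h h0 h1
    _ = _ := by ring

lemma JJ_l2 (hc : Continuous φ) (hp : Function.Periodic φ 1) (hB : HB 0 φ B) (h : ℝ) :
    ∫ x in (0:ℝ)..1, (JJ φ h x) ^ 2 ≤ |h| ^ 2 * B := by
  refine l2mult hB (JJ_cont hc h) fun k => ?_
  rw [co_JJ hc hp, norm_mul, Real.rpow_zero, one_mul]
  gcongr; exact mm_le k h

lemma JJ_sup (hc : Continuous φ) (hp : Function.Periodic φ 1) (hB : HB r φ B) {θ : ℝ} (h0 : 0 ≤ θ)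
    (h1 : θ ≤ 1) (hθ : θ ≤ r + 1/4) {H h : ℝ} (hH : |h| ≤ H) (x : ℝ) :
    |JJ φ h x| ≤ (1 + H) * |h| ^ θ * (ZZ + B) := by
  have hH0 : 0 ≤ H := (abs_nonneg h).trans hH
  refine supmult (β := θ - 1) hB (by linarith) (by positivity) (JJ_cont hc h) (JJ_per hp h) (fun k => ?_) x
  rw [co_JJ hc hp, norm_mul]
  calc _ ≤ ((1 + H) * (jj k ^ (θ - 1) * |h| ^ θ)) * ‖co φ k‖ := by gcongr; exact mm_bound k hH h0 h1
    _ = _ := by ring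

lemma diff2_l2 (hc : Continuous φ) (hp : Function.Periodic φ 1) (hr0 : 0 ≤ r) (hr1 : r ≤ 1)
    (hB : HB (1 + r) φ B) (h : ℝ) :
    ∫ x in (0:ℝ)..1, (φ (x + h) - 2 * φ x + φ (x - h)) ^ 2 ≤ ((4 * Real.pi) ^ 2 * (|h| * |h| ^ r)) ^ 2 * B := by
  refine l2mult hB (by fun_prop) fun k => ?_
  rw [co_diff2 hc hp]
  have h1 := ee_bound k h zero_le_one le_rfl
  have h2 := ee_bound k (-h) hr0 hr1
  rw [abs_neg] at h2
  rw [Real.rpow_one, Real.rpow_one] at h1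
  rw [Real.rpow_add (jj_pos k), Real.rpow_one]
  have hj := jj_pos k
  calc _ ≤ (4 * Real.pi * (jj k * |h|)) * (4 * Real.pi * (jj k ^ r * |h| ^ r)) * ‖co φ k‖ := by gcongr
    _ = _ := by ring

lemma JJ2_l2 (hc : Continuous φ) (hp : Function.Periodic φ 1) (hr0 : 0 ≤ r) (hr1 : r ≤ 1)
    (hB : HB r φ B) (h : ℝ) :
    ∫ x in (0:ℝ)..1, (JJ φ h (x + -h) - JJ φ h x) ^ 2 ≤ (4 * Real.pi * (|h| * |h| ^ r)) ^ 2 * B := by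
  have hJ := JJ_cont hc h
  refine l2mult hB (by fun_prop) fun k => ?_
  rw [co_diff hJ (JJ_per hp h), co_JJ hc hp, norm_mul, norm_mul]
  have h2 := ee_bound k (-h) hr0 hr1
  rw [abs_neg] at h2
  have h1 := mm_le k h
  have hj := jj_pos k
  calc _ ≤ (4 * Real.pi * (jj k ^ r * |h| ^ r)) * (|h| * ‖co φ k‖) := by gcongr
    _ = _ := by ring
end ests

lemma dal_cos {φ : ℝ → ℝ} (hn : Nice φ) (ρ x : ℝ) :
    HasSum (fun k : ℤ => (Real.cos (2 * Real.pi * |(k:ℝ)| * ρ) : ℂ) * co φ k * ee k x)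
      (((φ (x + ρ) + φ (x - ρ)) / 2 : ℝ) : ℂ) := by
  have h1 := series hn.cont hn.per hn.summ (x + ρ)
  have h2 := series hn.cont hn.per hn.summ (x - ρ)
  have h3 := (h1.add h2).div_const 2
  rw [Complex.ofReal_div, Complex.ofReal_add, Complex.ofReal_ofNat]
  refine h3.congr_fun' fun k => ?_
  rw [sub_eq_add_neg, ee_add, ee_add]
  have : (Real.cos (2 * Real.pi * |(k:ℝ)| * ρ) : ℂ) = (ee k ρ + ee k (-ρ)) / 2 := by
    have : Real.cos (2 * Real.pi * |(k:ℝ)| * ρ) = Real.cos (2 * Real.pi * k * ρ) := by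
      rcases abs_choice (k:ℝ) with h | h <;> rw [h]
      rw [← Real.cos_neg]; congr 1; ring
    rw [this, ee_eq, ee_eq, Complex.ofReal_cos, Complex.cos]
    congr 3; push_cast; ring_nf
  rw [this]; ring

lemma sym_int (k : ℤ) (ρ : ℝ) : ∫ z in (-ρ)..ρ, ee k z = 2 * ((snc (2 * Real.pi * |(k:ℝ)|) ρ : ℝ) : ℂ) := by
  have hI : ∀ a b, IntervalIntegrable (ee k) volume a b := fun a b => (ee_cont k).intervalIntegrable a b
  by_cases hk : k = 0
  · subst hk
    have : ∀ z, ee 0 z = 1 := fun z => by simp [ee]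
    simp only [this, snc]
    simp; ring
  have h0 : ∫ z in (-ρ)..ρ, ee k z = mm k ρ - mm k (-ρ) := by
    unfold mm
    rw [intervalIntegral.integral_interval_sub_left (hI _ _) (hI _ _)]
  rw [h0]
  have h1 := mm_mul k ρ
  have h2 := mm_mul k (-ρ)
  have hk' : (k:ℝ) ≠ 0 := by exact_mod_cast hk
  have hne : 2 * Real.pi * |(k:ℝ)| ≠ 0 := by have := Real.pi_ne_zero; positivity
  have hsn : snc (2 * Real.pi * |(k:ℝ)|) ρ = Real.sin (2 * Real.pi * k * ρ) / (2 * Real.pi * k) := by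
    unfold snc; rw [if_neg hne]
    rcases abs_choice (k:ℝ) with h | h <;> rw [h]
    rw [show 2 * Real.pi * -(k:ℝ) * ρ = -(2 * Real.pi * k * ρ) by ring, Real.sin_neg,
      show 2 * Real.pi * -(k:ℝ) = -(2 * Real.pi * k) by ring, neg_div_neg_eq]
  have hs : (Real.sin (2 * Real.pi * k * ρ) : ℂ) = (ee k (-ρ) - ee k ρ) * Complex.I / 2 := by
    rw [ee_eq, ee_eq, Complex.ofReal_sin, Complex.sin]
    congr 4; push_cast; ring_nf
  have hkc : (k:ℂ) ≠ 0 := by exact_mod_cast hk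
  have hpc : (Real.pi:ℂ) ≠ 0 := by exact_mod_cast Real.pi_ne_zero
  rw [hsn, Complex.ofReal_div, hs]
  have hne2 : 2 * (Real.pi:ℂ) * Complex.I * k ≠ 0 := by simp [hkc, hpc]
  apply mul_left_cancel₀ hne2
  rw [mul_sub, h1, h2]
  push_cast
  field_simp
  linear_combination (ee k ρ - ee k (-ρ)) * Complex.I_sq

lemma dal_sin {φ : ℝ → ℝ} (hn : Nice φ) (ρ x : ℝ) :
    HasSum (fun k : ℤ => ((snc (2 * Real.pi * |(k:ℝ)|) ρ : ℝ) : ℂ) * co φ k * ee k x)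
      (((∫ z in (-ρ)..ρ, φ (x + z)) / 2 : ℝ) : ℂ) := by
  have hc := hn.cont
  have hco : ∀ k, co (fun x => ∫ z in (-ρ)..ρ, φ (x + z)) k
      = 2 * ((snc (2 * Real.pi * |(k:ℝ)|) ρ : ℝ) : ℂ) * co φ k := fun k => by
    rw [co_prim hn.cont hn.per, sym_int]
  have hs : Summable (co (fun x => ∫ z in (-ρ)..ρ, φ (x + z))) := by
    refine Summable.of_norm_bounded (hn.summ.norm.mul_left |ρ - -ρ|) fun k => ?_
    rw [co_prim hn.cont hn.per, norm_mul]
    gcongr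
    have := intervalIntegral.norm_integral_le_of_norm_le_const (a := -ρ) (b := ρ) (f := ee k) (C := 1)
      (fun x _ => (norm_ee k x).le)
    simpa using this
  have h1 := series (φ := fun x => ∫ z in (-ρ)..ρ, φ (x + z)) (by fun_prop) (by
    intro x
    refine intervalIntegral.integral_congr fun z _ => ?_
    rw [add_right_comm, hn.per]) hs x
  have h2 := h1.div_const 2
  push_cast
  refine h2.congr_fun' fun k => ?_
  rw [hco]; ring

lemma comp_nice {φ f : ℝ → ℝ} {B L : ℝ} (hc : Continuous φ) (hp : Function.Periodic φ 1) (hB : HB 1 φ B)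
    (hf : ∀ a b, |f a - f b| ≤ L * |a - b|) (hfc : Continuous f) : Nice (fun x => f (φ x)) := by
  have hψ : Continuous (fun x => f (φ x)) := by fun_prop
  have hψp : Function.Periodic (fun x => f (φ x)) 1 := fun x => by simp only [hp x]
  have hP := parseval hψ
  have key : ∀ (S : Finset ℤ) (h : ℝ), ∑ k ∈ S, ‖ee k h - 1‖ ^ 2 * ‖co (fun x => f (φ x)) k‖ ^ 2
      ≤ L ^ 2 * ((2 * Real.pi * |h|) ^ 2 * B) := by
    intro S h
    have hd := parseval (φ := fun x => f (φ (x + h)) - f (φ x)) (by fun_prop)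
    have e : ∀ k, ‖co (fun x => f (φ (x + h)) - f (φ x)) k‖ ^ 2
      = ‖ee k h - 1‖ ^ 2 * ‖co (fun x => f (φ x)) k‖ ^ 2 := fun k => by
      rw [co_diff hψ hψp, norm_mul, mul_pow]
    simp only [e] at hd
    refine (sum_le_hasSum S (fun k _ => by positivity) hd).trans ?_
    refine le_trans ?_ (mul_le_mul_of_nonneg_left (diff_l2 hc hp hB h) (sq_nonneg L))
    rw [← intervalIntegral.integral_const_mul]
    refine intervalIntegral.integral_mono_on zero_le_one (Continuous.intervalIntegrable (by fun_prop) _ _)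
      (Continuous.intervalIntegrable (by fun_prop) _ _) fun x _ => ?_
    have := hf (φ (x + h)) (φ x)
    rw [← sq_abs, ← sq_abs (φ (x + h) - φ x), ← mul_pow]
    gcongr
  have key2 : ∀ S : Finset ℤ, ∑ k ∈ S, |(k:ℝ)| ^ 2 * ‖co (fun x => f (φ x)) k‖ ^ 2 ≤ L ^ 2 * B := by
    intro S
    have ht : Filter.Tendsto (fun h : ℝ => ∑ k ∈ S, ‖h⁻¹ • (ee k (0 + h) - ee k 0)‖ ^ 2 * ‖co (fun x => f (φ x)) k‖ ^ 2)
        (nhdsWithin 0 {0}ᶜ) (nhds (∑ k ∈ S, ‖(2 * (Real.pi:ℂ) * Complex.I * k) * ee k 0‖ ^ 2 * ‖co (fun x => f (φ x)) k‖ ^ 2)) := by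
      refine tendsto_finsetSum _ fun k _ => ?_
      exact ((((hasDerivAt_iff_tendsto_slope_zero.mp (ee_deriv k 0)).norm).pow 2).mul_const _)
    have hle := le_of_tendsto (b := L ^ 2 * ((2 * Real.pi) ^ 2 * B)) ht (by
      filter_upwards [self_mem_nhdsWithin] with h hh
      have hh' : h ≠ 0 := hh
      have := key S h
      have e : ∀ k, ‖h⁻¹ • (ee k (0 + h) - ee k 0)‖ ^ 2 * ‖co (fun x => f (φ x)) k‖ ^ 2
        = (h ^ 2)⁻¹ * (‖ee k h - 1‖ ^ 2 * ‖co (fun x => f (φ x)) k‖ ^ 2) := fun k => by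
        rw [norm_smul, zero_add, ee_zero, mul_pow, norm_inv, inv_pow, Real.norm_eq_abs, sq_abs]; ring
      simp only [e]
      rw [← Finset.mul_sum, inv_mul_le_iff₀ (by positivity)]
      refine this.trans (le_of_eq ?_)
      rw [mul_pow, sq_abs]; ring)
    have e : ∀ k : ℤ, ‖(2 * (Real.pi:ℂ) * Complex.I * k) * ee k 0‖ ^ 2 * ‖co (fun x => f (φ x)) k‖ ^ 2
        = (2 * Real.pi) ^ 2 * (|(k:ℝ)| ^ 2 * ‖co (fun x => f (φ x)) k‖ ^ 2) := fun k => by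
      rw [ee_zero]
      simp only [norm_mul, Complex.norm_I, Complex.norm_real, Complex.norm_ofNat, Complex.norm_intCast,
        Real.norm_eq_abs, abs_of_pos Real.pi_pos, mul_one]
      ring
    simp only [e] at hle
    rw [← Finset.mul_sum] at hle
    have h4 : (0:ℝ) < (2 * Real.pi) ^ 2 := by positivity
    refine le_of_mul_le_mul_left ?_ h4
    linarith
  have hs := summable_of_sum_le (fun k => by positivity) key2
  have hs1 : Summable (fun k => jj k ^ (2 * (1:ℝ)) * ‖co (fun x => f (φ x)) k‖ ^ 2) := by
    refine Summable.of_nonneg_of_le (fun k => by have := jj_pos k; positivity) (fun k => ?_) (hs.add hP.summable)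
    rw [← add_one_mul]
    gcongr
    rw [mul_one, Real.rpow_two]
    unfold jj
    rcases max_choice |(k:ℝ)| 1 with h | h <;> rw [h] <;> nlinarith [sq_nonneg |(k:ℝ)|]
  exact HB.nice (α := 1) ⟨hs1, le_rfl⟩ (by norm_num) hψ hψp

/-- one dimensional section of a field on the one-dimensional torus -/
def sec (w : Fn 1) (x : ℝ) : ℝ := w (fun _ => x)

lemma pt_eq (x : Pt 1) : x = fun _ => x 0 := by ext i; rw [Subsingleton.elim i 0]

lemma ix_eq (k : Fin 1 → ℤ) : k = fun _ => k 0 := by ext i; rw [Subsingleton.elim i 0]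

lemma ch_ee (k : Fin 1 → ℤ) (x : Pt 1) : ch k x = ee (k 0) (x 0) := by
  simp [ch, ee]

lemma freq_eq (k : Fin 1 → ℤ) : freq k = |(k 0 : ℝ)| := by
  simp [freq, Real.sqrt_sq_eq_abs]

lemma jb_eq (k : Fin 1 → ℤ) : jb k = jj (k 0) := by rw [jb, freq_eq, jj]

lemma omg_eq (k : Fin 1 → ℤ) : omg k = 2 * Real.pi * |(k 0 : ℝ)| := by rw [omg, freq_eq]

lemma fc_co (w : Fn 1) (k : Fin 1 → ℤ) : fc w k = co (sec w) (k 0) := by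
  unfold fc co
  rw [intervalIntegral.integral_of_le zero_le_one, ← integral_Ico_eq_integral_Ioc]
  refine (((volume_preserving_funUnique (Fin 1) ℝ).symm _).setIntegral_preimage_emb
      (MeasurableEquiv.measurableEmbedding _) (fun x : Pt 1 => (w x : ℂ) * ch (-k) x) (box 1)).symm.trans ?_
  have : (MeasurableEquiv.funUnique (Fin 1) ℝ).symm ⁻¹' (box 1) = Ico (0:ℝ) 1 := by
    ext x; simp [box, MeasurableEquiv.funUnique]
  rw [this]
  refine setIntegral_congr_fun measurableSet_Ico fun x _ => ?_
  rw [ch_ee]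
  rfl

lemma tsum_ix {E : Type*} [AddCommMonoid E] [TopologicalSpace E] (c : ℤ → E) :
    ∑' k : Fin 1 → ℤ, c (k 0) = ∑' k, c k :=
  (Equiv.funUnique (Fin 1) ℤ).tsum_eq c

lemma summable_ix {E : Type*} [AddCommMonoid E] [TopologicalSpace E] (c : ℤ → E) :
    Summable (fun k : Fin 1 → ℤ => c (k 0)) ↔ Summable c :=
  (Equiv.funUnique (Fin 1) ℤ).summable_iff (f := c)

lemma memSob_iff (α : ℝ) (w : Fn 1) :
    MemSob α w ↔ Summable (fun k => jj k ^ (2 * α) * ‖co (sec w) k‖ ^ 2) := by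
  unfold MemSob
  simp only [jb_eq, fc_co]
  exact summable_ix (fun k => jj k ^ (2 * α) * ‖co (sec w) k‖ ^ 2)

lemma sob_sq (α : ℝ) (w : Fn 1) :
    sob α w ^ 2 = ∑' k, jj k ^ (2 * α) * ‖co (sec w) k‖ ^ 2 := by
  unfold sob
  simp only [jb_eq, fc_co]
  rw [tsum_ix (fun k => jj k ^ (2 * α) * ‖co (sec w) k‖ ^ 2), Real.sq_sqrt]
  exact tsum_nonneg fun k => by have := jj_pos k; positivity

lemma HB_of {α B : ℝ} {w : Fn 1} (h : MemSob α w) (hB : sob α w ^ 2 ≤ B) : HB α (sec w) B :=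
  ⟨(memSob_iff α w).mp h, by rwa [← sob_sq]⟩

lemma nice_of_series {w : ℝ → ℝ} (h : ∀ x, w x = (∑' k, co w k * ee k x).re) : Nice w := by
  have hs : Summable (co w) := by
    by_contra hn
    have hz : w = fun _ => 0 := by
      ext x
      rw [h x, tsum_eq_zero_of_not_summable]
      · simp
      · intro hs
        apply hn
        refine Summable.of_norm ?_
        have := hs.norm
        simpa [norm_ee] using this
    apply hn
    rw [hz]
    have : co (fun _ => 0) = fun _ => 0 := by ext k; simp [co]
    rw [this]; exact summable_zero
  refine ⟨?_, ?_, hs⟩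
  · rw [funext h]
    refine Complex.continuous_re.comp ?_
    refine continuous_tsum (fun k => (ee_cont k).const_mul _) hs.norm fun k x => ?_
    rw [norm_mul, norm_ee, mul_one]
  · intro x
    rw [h (x+1), h x]
    simp only [ee_periodic _ x]

lemma snc_zero (ω : ℝ) : snc ω 0 = 0 := by unfold snc; split_ifs <;> simp

lemma nice_of_fix {W : Pair 1} (h : W = expL 0 W) : Nice (sec W.1) ∧ Nice (sec W.2) := by
  constructor
  · apply nice_of_series
    intro x
    have := congrFun (congrArg Prod.fst h) (fun _ => x)
    simp only [expL, mul_zero, Real.cos_zero, snc_zero, ch_ee, fc_co] at this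
    rw [sec, this, tsum_ix (fun k => (((1:ℝ):ℂ) * co (sec W.1) k + ((0:ℝ):ℂ) * co (sec W.2) k) * ee k x)]
    simp
  · apply nice_of_series
    intro x
    have := congrFun (congrArg Prod.snd h) (fun _ => x)
    simp only [expL, mul_zero, Real.cos_zero, Real.sin_zero, ch_ee, fc_co] at this
    rw [sec, this, tsum_ix (fun k => (((0:ℝ):ℂ) * co (sec W.1) k + ((1:ℝ):ℂ) * co (sec W.2) k) * ee k x)]
    simp

lemma expL_fst {W : Pair 1} (h1 : Nice (sec W.1)) (h2 : Nice (sec W.2)) (ρ x : ℝ) :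
    (expL ρ W).1 (fun _ => x) = (sec W.1 (x + ρ) + sec W.1 (x - ρ)) / 2
      + (∫ z in (-ρ)..ρ, sec W.2 (x + z)) / 2 := by
  have h := (dal_cos h1 ρ x).add (dal_sin h2 ρ x)
  rw [← Complex.ofReal_add] at h
  simp only [← add_mul] at h
  simp only [expL, omg_eq, ch_ee, fc_co]
  rw [tsum_ix (fun k => ((Real.cos (2 * Real.pi * |(k:ℝ)| * ρ) : ℂ) * co (sec W.1) k
    + ((snc (2 * Real.pi * |(k:ℝ)|) ρ : ℝ) : ℂ) * co (sec W.2) k) * ee k x), h.tsum_eq, Complex.ofReal_re]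

lemma nice_zero : Nice (fun _ => 0) := by
  refine ⟨continuous_const, fun x => rfl, ?_⟩
  have : co (fun _ => 0) = fun _ => 0 := by ext k; simp [co]
  rw [this]; exact summable_zero

lemma expL_F_fst {W : Pair 1} {f : ℝ → ℝ} (h : Nice (fun x => f (sec W.1 x))) (ρ x : ℝ) :
    (expL ρ (Fnl f W)).1 (fun _ => x) = (∫ z in (-ρ)..ρ, f (sec W.1 (x + z))) / 2 := by
  rw [expL_fst (W := Fnl f W) nice_zero h]
  simp [sec, Fnl]

lemma expL_F_snd {W : Pair 1} {f : ℝ → ℝ} (h : Nice (fun x => f (sec W.1 x))) (ρ x : ℝ) :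
    (expL ρ (Fnl f W)).2 (fun _ => x) = (f (sec W.1 (x + ρ)) + f (sec W.1 (x - ρ))) / 2 := by
  have hh := dal_cos h ρ x
  simp only [expL, omg_eq, ch_ee, fc_co]
  have hz : ∀ k, co (sec (Fnl f W).1) k = 0 := fun k => by simp [co, sec, Fnl]
  have hg : sec (Fnl f W).2 = fun x => f (sec W.1 x) := rfl
  simp only [hz, hg, mul_zero, zero_add]
  rw [tsum_ix (fun k => (Real.cos (2 * Real.pi * |(k:ℝ)| * ρ) : ℂ) * co (fun x => f (sec W.1 x)) k * ee k x),
    hh.tsum_eq, Complex.ofReal_re]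

/-- Bound of the `H^1` norm through the derivative. -/
lemma h1_bound {D P : ℝ → ℝ} (hD : ∀ x, HasDerivAt D (P x) x) (hP : Continuous P)
    (hp : Function.Periodic D 1) :
    ∑' k, jj k ^ (2 * (1:ℝ)) * ‖co D k‖ ^ 2 ≤ (∫ x in (0:ℝ)..1, D x ^ 2) + ∫ x in (0:ℝ)..1, P x ^ 2 := by
  have hDc : Continuous D := continuous_iff_continuousAt.mpr fun x => (hD x).continuousAt
  have h := (parseval hDc).add (parseval hP)
  rw [← h.tsum_eq]
  have hle : ∀ k, jj k ^ (2 * (1:ℝ)) * ‖co D k‖ ^ 2 ≤ ‖co D k‖ ^ 2 + ‖co P k‖ ^ 2 := by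
    intro k
    rw [mul_one, Real.rpow_two]
    rcases co_deriv hD hP hp k with hk | hk
    · by_cases h0 : k = 0
      · subst h0; rw [jj_zero]; nlinarith [sq_nonneg ‖co P 0‖]
      rw [← hk, jj_ne h0]
      have := Real.pi_gt_three
      have h5 : (1:ℝ) ≤ (2 * Real.pi) ^ 2 := by nlinarith
      have h6 : 0 ≤ |(k:ℝ)| ^ 2 * ‖co D k‖ ^ 2 := by positivity
      nlinarith [sq_nonneg ‖co D k‖]
    · subst hk; rw [jj_zero]; nlinarith [sq_nonneg ‖co P 0‖]
  exact (Summable.of_nonneg_of_le (fun k => by have := jj_pos k; positivity) hle h.summable).tsum_le_tsum hle h.summable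

lemma h0_bound {P : ℝ → ℝ} (hP : Continuous P) :
    ∑' k, jj k ^ (2 * (0:ℝ)) * ‖co P k‖ ^ 2 ≤ ∫ x in (0:ℝ)..1, P x ^ 2 := by
  simp only [mul_zero, Real.rpow_zero, one_mul]
  rw [(parseval hP).tsum_eq]

def cl (T t : ℝ) : ℝ := max 0 (min T t)

lemma cl_mem {T : ℝ} (hT : 0 ≤ T) (t : ℝ) : cl T t ∈ Icc (0:ℝ) T := by
  unfold cl; exact ⟨le_max_left _ _, max_le hT (min_le_left _ _)⟩

lemma cl_of_mem {T t : ℝ} (h : t ∈ Icc (0:ℝ) T) : cl T t = t := by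
  unfold cl; rw [min_eq_right h.2, max_eq_right h.1]

lemma cl_cont (T : ℝ) : Continuous (cl T) := by unfold cl; fun_prop

structure Core (u : ℝ → ℝ → ℝ) (T r θ K : ℝ) : Prop where
  per : ∀ t ∈ Icc (0:ℝ) T, Function.Periodic (u t) 1
  hold : ∀ t ∈ Icc (0:ℝ) T, ∀ t' ∈ Icc (0:ℝ) T, ∀ x x', |u t' x' - u t x| ≤ K * (|t' - t| ^ θ + |x' - x| ^ θ)
  p3 : ∀ ε : ℝ, (ε = 1 ∨ ε = -1) → ∀ t s : ℝ, 0 ≤ t → 0 < s → t + s ≤ T →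
    ∫ y in (0:ℝ)..1, (u (t + s) (y + ε * s) - u t y) ^ 2 ≤ K * s ^ 2
  p4 : ∀ ε : ℝ, (ε = 1 ∨ ε = -1) → ∀ t s : ℝ, 0 ≤ t - s → 0 < s → t + s ≤ T →
    ∫ y in (0:ℝ)..1, (u (t + s) (y + ε * s) + u (t - s) (y - ε * s) - 2 * u t y) ^ 2 ≤ K * (s ^ 2 * s ^ (2 * r))

structure FOK (f f1 : ℝ → ℝ) (L : ℝ) : Prop where
  cont : Continuous f
  lip : ∀ a b, |f a - f b| ≤ L * |a - b|
  bd : ∀ a, |f1 a| ≤ L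
  tay : ∀ w a, |f (w + a) - f w - f1 w * a| ≤ L * a ^ 2

lemma FOK.second {f f1 : ℝ → ℝ} {L : ℝ} (h : FOK f f1 L) (x y w : ℝ) :
    (f x + f y - 2 * f w) ^ 2 ≤ 2 * L ^ 2 * (x + y - 2 * w) ^ 2 + 4 * L ^ 2 * ((x - w) ^ 4 + (y - w) ^ 4) := by
  have hL : 0 ≤ L := (abs_nonneg _).trans (h.bd 0)
  have h1 := h.tay w (x - w)
  have h2 := h.tay w (y - w)
  rw [add_sub_cancel] at h1 h2
  have h3 : |f1 w * (x + y - 2 * w)| ≤ L * |x + y - 2 * w| := by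
    rw [abs_mul]; gcongr; exact h.bd w
  have h4 : |f x + f y - 2 * f w| ≤ L * |x + y - 2 * w| + L * ((x - w) ^ 2 + (y - w) ^ 2) := by
    rw [show f x + f y - 2 * f w = (f x - f w - f1 w * (x - w)) + (f y - f w - f1 w * (y - w))
      + f1 w * (x + y - 2 * w) by ring]
    refine (abs_add_le _ _).trans ?_
    have := abs_add_le (f x - f w - f1 w * (x - w)) (f y - f w - f1 w * (y - w))
    linarith
  rw [← sq_abs (f x + f y - 2 * f w), ← sq_abs (x + y - 2 * w)]
  set q := |x + y - 2 * w|
  set a := (x - w) ^ 2 with ha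
  set b := (y - w) ^ 2 with hb
  have ea : (x - w) ^ 4 = a ^ 2 := by rw [ha]; ring
  have eb : (y - w) ^ 4 = b ^ 2 := by rw [hb]; ring
  rw [ea, eb]
  calc |f x + f y - 2 * f w| ^ 2 ≤ (L * q + L * (a + b)) ^ 2 := by gcongr
    _ ≤ _ := by nlinarith [mul_nonneg (sq_nonneg L) (sq_nonneg (q - (a + b))), mul_nonneg (sq_nonneg L) (sq_nonneg (a - b))]

lemma cs_int {q : ℝ → ℝ} (hq : Continuous q) {τ : ℝ} (hτ : 0 < τ) :
    (∫ s in (0:ℝ)..τ, q s) ^ 2 ≤ τ * ∫ s in (0:ℝ)..τ, q s ^ 2 := by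
  set I := ∫ s in (0:ℝ)..τ, q s with hI
  have h0 : 0 ≤ ∫ s in (0:ℝ)..τ, (τ * q s - I) ^ 2 :=
    intervalIntegral.integral_nonneg hτ.le fun s _ => sq_nonneg _
  have h1 : ∫ s in (0:ℝ)..τ, (τ * q s - I) ^ 2
      = τ ^ 2 * (∫ s in (0:ℝ)..τ, q s ^ 2) - 2 * τ * I * I + τ * I ^ 2 := by
    have e : ∀ s, (τ * q s - I) ^ 2 = τ ^ 2 * q s ^ 2 - 2 * τ * I * q s + I ^ 2 := fun s => by ring
    simp only [e]
    rw [intervalIntegral.integral_add, intervalIntegral.integral_sub, intervalIntegral.integral_const_mul,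
      intervalIntegral.integral_const_mul, intervalIntegral.integral_const, smul_eq_mul, sub_zero]
    all_goals exact Continuous.intervalIntegrable (by fun_prop) _ _
  rw [h1] at h0
  have : 0 ≤ τ * (τ * (∫ s in (0:ℝ)..τ, q s ^ 2) - I ^ 2) := by nlinarith
  have := nonneg_of_mul_nonneg_right this hτ
  linarith

lemma per_int {ψ : ℝ → ℝ} (hp : Function.Periodic ψ 1) (c : ℝ) :
    ∫ x in (0:ℝ)..1, ψ (x + c) = ∫ x in (0:ℝ)..1, ψ x := by
  rw [intervalIntegral.integral_comp_add_right]
  have := hp.intervalIntegral_add_eq c 0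
  simpa [add_comm] using this

lemma imono {φ ψ : ℝ → ℝ} (hφ : Continuous φ) (hψ : Continuous ψ) {a b : ℝ} (hab : a ≤ b)
    (h : ∀ x ∈ Icc a b, φ x ≤ ψ x) : ∫ x in a..b, φ x ≤ ∫ x in a..b, ψ x :=
  intervalIntegral.integral_mono_on hab (hφ.intervalIntegrable _ _) (hψ.intervalIntegrable _ _) h

lemma deriv_int {I p : ℝ → ℝ → ℝ} (hI : Continuous (Function.uncurry I)) (hp : Continuous (Function.uncurry p))
    (h : ∀ s x, HasDerivAt (I s) (p s x) x) (a b x : ℝ) :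
    HasDerivAt (fun x => ∫ s in a..b, I s x) (∫ s in a..b, p s x) x := by
  have hp' : Continuous (fun q : ℝ × ℝ => p q.1 q.2) := hp
  have hI' : Continuous (fun q : ℝ × ℝ => I q.1 q.2) := hI
  have hP : Continuous (fun y => ∫ s in a..b, p s y) := by
    apply intervalIntegral.continuous_parametric_intervalIntegral_of_continuous'
    unfold Function.uncurry; fun_prop
  have e : (fun x => ∫ s in a..b, I s x) = fun x => (∫ s in a..b, I s 0) + ∫ y in (0:ℝ)..x, ∫ s in a..b, p s y := by
    ext x
    rw [swapr (F := fun y s => p s y) (by unfold Function.uncurry; fun_prop), ← intervalIntegral.integral_add]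
    · refine intervalIntegral.integral_congr fun s _ => ?_
      beta_reduce
      rw [intervalIntegral.integral_eq_sub_of_hasDerivAt (fun y _ => h s y)]
      · ring
      · exact Continuous.intervalIntegrable (by fun_prop) _ _
    · exact Continuous.intervalIntegrable (by fun_prop) _ _
    · apply Continuous.intervalIntegrable
      apply intervalIntegral.continuous_parametric_intervalIntegral_of_continuous'
      exact hp
  rw [e]
  exact (hP.integral_hasStrictDerivAt 0 x).hasDerivAt.const_add _

noncomputable def D1 (g : ℝ → ℝ → ℝ) (t τ x : ℝ) : ℝ :=
  ∫ s in (-τ)..τ, ((∫ z in (-(τ - s))..(τ - s), g (t + s) (x + z)) / 2 - (∫ z in (-τ)..τ, g t (x + z)) / 2)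

noncomputable def D2 (g : ℝ → ℝ → ℝ) (t τ x : ℝ) : ℝ :=
  ∫ s in (-τ)..τ, ((g (t + s) (x + (τ - s)) + g (t + s) (x - (τ - s))) / 2 - (g t (x + τ) + g t (x - τ)) / 2)

noncomputable def P1 (g : ℝ → ℝ → ℝ) (t τ x : ℝ) : ℝ :=
  ∫ s in (-τ)..τ, ((g (t + s) (x + (τ - s)) - g (t + s) (x - (τ - s))) / 2 - (g t (x + τ) - g t (x - τ)) / 2)

noncomputable def EE (g : ℝ → ℝ → ℝ) (ε t τ y : ℝ) : ℝ :=
  ∫ s in (-τ)..τ, (g (t + s) (y + ε * s) - g t y)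

section gen
variable {g : ℝ → ℝ → ℝ}

lemma scaled (_hg : Continuous (fun q : ℝ × ℝ => g q.1 q.2)) (ρ t x : ℝ) : ∫ z in (-ρ)..ρ, g t (x + z) = ρ * ∫ ζ in (-1:ℝ)..1, g t (x + ρ * ζ) := by
  have := intervalIntegral.mul_integral_comp_mul_left (a := -1) (b := 1) (f := fun z => g t (x + z)) (c := ρ)
  rw [this]; simp

lemma inner_deriv (hg : Continuous (fun q : ℝ × ℝ => g q.1 q.2)) (ρ t x : ℝ) : HasDerivAt (fun x => ∫ z in (-ρ)..ρ, g t (x + z)) (g t (x + ρ) - g t (x - ρ)) x := by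
  have hc : Continuous (g t) := by fun_prop
  have e : (fun x => ∫ z in (-ρ)..ρ, g t (x + z)) = fun x => (∫ z in (0:ℝ)..(x + ρ), g t z) - ∫ z in (0:ℝ)..(x - ρ), g t z := by
    ext x
    rw [intervalIntegral.integral_comp_add_left (fun z => g t z),
      intervalIntegral.integral_interval_sub_left (hc.intervalIntegrable _ _) (hc.intervalIntegrable _ _)]
    simp [sub_eq_add_neg]
  rw [e]
  have h1 := ((hc.integral_hasStrictDerivAt 0 (x + ρ)).hasDerivAt).comp_add_const x ρ
  have h2 := ((hc.integral_hasStrictDerivAt 0 (x - ρ)).hasDerivAt).comp_sub_const x ρ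
  exact h1.sub h2

lemma scaled_cont (hg : Continuous (fun q : ℝ × ℝ => g q.1 q.2)) : Continuous (fun q : ℝ × ℝ × ℝ => q.1 * ∫ ζ in (-1:ℝ)..1, g q.2.1 (q.2.2 + q.1 * ζ)) := by
  refine continuous_fst.mul ?_
  apply intervalIntegral.continuous_parametric_intervalIntegral_of_continuous'
  unfold Function.uncurry
  fun_prop

lemma D1_deriv (hg : Continuous (fun q : ℝ × ℝ => g q.1 q.2)) (t τ x : ℝ) : HasDerivAt (D1 g t τ) (P1 g t τ x) x := by
  unfold D1 P1
  refine deriv_int (I := fun s x => (∫ z in (-(τ - s))..(τ - s), g (t + s) (x + z)) / 2 - (∫ z in (-τ)..τ, g t (x + z)) / 2)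
    (p := fun s x => (g (t + s) (x + (τ - s)) - g (t + s) (x - (τ - s))) / 2 - (g t (x + τ) - g t (x - τ)) / 2) ?_ ?_ ?_ (-τ) τ x
  · simp only [scaled hg]
    have h1 := (scaled_cont hg).comp (g := fun q : ℝ × ℝ × ℝ => q.1 * ∫ ζ in (-1:ℝ)..1, g q.2.1 (q.2.2 + q.1 * ζ)) (f := fun q : ℝ × ℝ => (τ - q.1, t + q.1, q.2)) (by fun_prop)
    have h2 := (scaled_cont hg).comp (g := fun q : ℝ × ℝ × ℝ => q.1 * ∫ ζ in (-1:ℝ)..1, g q.2.1 (q.2.2 + q.1 * ζ)) (f := fun q : ℝ × ℝ => (τ, t, q.2)) (by fun_prop)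
    exact (h1.div_const 2).sub (h2.div_const 2)
  · unfold Function.uncurry; fun_prop
  · intro s x
    exact ((inner_deriv hg (τ - s) (t + s) x).div_const 2).sub ((inner_deriv hg τ t x).div_const 2)

lemma EE_cont (hg : Continuous (fun q : ℝ × ℝ => g q.1 q.2)) (ε t τ : ℝ) : Continuous (EE g ε t τ) := by
  unfold EE
  apply intervalIntegral.continuous_parametric_intervalIntegral_of_continuous'
  unfold Function.uncurry; fun_prop

lemma P1_eq (hg : Continuous (fun q : ℝ × ℝ => g q.1 q.2)) (t τ x : ℝ) : P1 g t τ x = (EE g (-1) t τ (x + τ) - EE g 1 t τ (x - τ)) / 2 := by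
  unfold P1 EE
  rw [← intervalIntegral.integral_sub, ← intervalIntegral.integral_div]
  · refine intervalIntegral.integral_congr fun s _ => ?_
    beta_reduce
    rw [show x + (τ - s) = x + τ + -1 * s by ring, show x - (τ - s) = x - τ + 1 * s by ring]
    ring
  all_goals exact Continuous.intervalIntegrable (by fun_prop) _ _

lemma D2_eq (hg : Continuous (fun q : ℝ × ℝ => g q.1 q.2)) (t τ x : ℝ) : D2 g t τ x = (EE g (-1) t τ (x + τ) + EE g 1 t τ (x - τ)) / 2 := by
  unfold D2 EE
  rw [← intervalIntegral.integral_add, ← intervalIntegral.integral_div]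
  · refine intervalIntegral.integral_congr fun s _ => ?_
    beta_reduce
    rw [show x + (τ - s) = x + τ + -1 * s by ring, show x - (τ - s) = x - τ + 1 * s by ring]
    ring
  all_goals exact Continuous.intervalIntegrable (by fun_prop) _ _

lemma EE_fold (hg : Continuous (fun q : ℝ × ℝ => g q.1 q.2)) (ε t τ y : ℝ) :
    EE g ε t τ y = ∫ s in (0:ℝ)..τ, (g (t + s) (y + ε * s) + g (t - s) (y - ε * s) - 2 * g t y) := by
  unfold EE
  have hI : ∀ a b, IntervalIntegrable (fun s => g (t + s) (y + ε * s) - g t y) volume a b :=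
    fun a b => Continuous.intervalIntegrable (by fun_prop) _ _
  rw [← intervalIntegral.integral_add_adjacent_intervals (hI (-τ) 0) (hI 0 τ)]
  have h1 := intervalIntegral.integral_comp_neg (a := 0) (b := τ) (fun s => g (t + s) (y + ε * s) - g t y)
  rw [neg_zero] at h1
  rw [← h1, ← intervalIntegral.integral_add]
  · refine intervalIntegral.integral_congr fun s _ => ?_
    beta_reduce
    rw [show t + -s = t - s by ring, show y + ε * -s = y - ε * s by ring]
    ring
  all_goals exact Continuous.intervalIntegrable (by fun_prop) _ _

end gen

lemma Core.ucont {u : ℝ → ℝ → ℝ} {T r θ K : ℝ} (h : Core u T r θ K) (hθ : 0 < θ) (hT : 0 ≤ T) :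
    Continuous (fun q : ℝ × ℝ => u (cl T q.1) q.2) := by
  rw [continuous_iff_continuousAt]
  intro q0
  unfold ContinuousAt
  rw [tendsto_iff_dist_tendsto_zero]
  have hcl := cl_cont T
  have hc : Continuous (fun q : ℝ × ℝ => K * (|cl T q.1 - cl T q0.1| ^ θ + |q.2 - q0.2| ^ θ)) := by
    refine continuous_const.mul (Continuous.add ?_ ?_)
    · exact Continuous.rpow_const (by fun_prop) fun _ => Or.inr hθ.le
    · exact Continuous.rpow_const (by fun_prop) fun _ => Or.inr hθ.le
  have h0 := hc.tendsto q0
  simp only [sub_self, abs_zero, Real.zero_rpow hθ.ne', add_zero, mul_zero] at h0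
  refine squeeze_zero (fun _ => dist_nonneg) (fun q => ?_) h0
  rw [Real.dist_eq]
  exact h.hold _ (cl_mem hT _) _ (cl_mem hT _) _ _

lemma pow_cmp {T r θ s : ℝ} (hr : r ≤ θ) (hs : 0 < s) (hsT : s ≤ T) :
    (s ^ θ) ^ 2 ≤ (1 + T) ^ (2 * (θ - r)) * s ^ (2 * r) := by
  have e : (s ^ θ) ^ 2 = s ^ (2 * (θ - r)) * s ^ (2 * r) := by
    rw [← Real.rpow_natCast, ← Real.rpow_mul hs.le, ← Real.rpow_add hs]
    congr 1; push_cast; ring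
  rw [e]
  gcongr
  linarith

noncomputable def C1 (L K T r θ : ℝ) : ℝ := 2 * L ^ 2 * K + 32 * L ^ 2 * K ^ 3 * (1 + T) ^ (2 * (θ - r))

section conc
variable {u : ℝ → ℝ → ℝ} {T r θ K L : ℝ} {f f1 : ℝ → ℝ}

lemma four_bound {a : ℝ → ℝ} (ha : Continuous a) {S A : ℝ} (hS : ∀ y, |a y| ≤ S)
    (hA : ∫ y in (0:ℝ)..1, a y ^ 2 ≤ A) : ∫ y in (0:ℝ)..1, a y ^ 4 ≤ S ^ 2 * A := by
  calc ∫ y in (0:ℝ)..1, a y ^ 4 ≤ ∫ y in (0:ℝ)..1, S ^ 2 * a y ^ 2 := by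
        refine imono (by fun_prop) (by fun_prop) zero_le_one fun y _ => ?_
        have : a y ^ 2 ≤ S ^ 2 := by rw [← sq_abs]; gcongr; exact hS y
        nlinarith [sq_nonneg (a y)]
    _ = S ^ 2 * ∫ y in (0:ℝ)..1, a y ^ 2 := by rw [intervalIntegral.integral_const_mul]
    _ ≤ _ := by gcongr

lemma Q_bound (h : Core u T r θ K) (hf : FOK f f1 L) (hθ : 0 < θ) (hr : r ≤ θ) (hK : 0 ≤ K)
    {ε : ℝ} (hε : ε = 1 ∨ ε = -1) {t s : ℝ} (h1 : 0 ≤ t - s) (hs : 0 < s) (h2 : t + s ≤ T) :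
    ∫ y in (0:ℝ)..1, (f (u (t + s) (y + ε * s)) + f (u (t - s) (y - ε * s)) - 2 * f (u t y)) ^ 2
      ≤ C1 L K T r θ * (s ^ 2 * s ^ (2 * r)) := by
  have hT : 0 ≤ T := by linarith
  have m1 : t + s ∈ Icc (0:ℝ) T := ⟨by linarith, h2⟩
  have m2 : t - s ∈ Icc (0:ℝ) T := ⟨h1, by linarith⟩
  have m0 : t ∈ Icc (0:ℝ) T := ⟨by linarith, by linarith⟩
  have huc : ∀ t ∈ Icc (0:ℝ) T, Continuous (u t) := fun t ht => by
    have := (h.ucont hθ hT).comp (f := fun x : ℝ => (t, x)) (by fun_prop)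
    simpa [Function.comp_def, cl_of_mem ht] using this
  have c1 := huc _ m1
  have c2 := huc _ m2
  have c0 := huc _ m0
  have hfc := hf.cont
  have hes : |ε * s| = s := by
    rcases hε with rfl | rfl
    · rw [one_mul, abs_of_pos hs]
    · rw [neg_one_mul, abs_neg, abs_of_pos hs]
  have sa : ∀ y, |u (t + s) (y + ε * s) - u t y| ≤ 2 * K * s ^ θ := fun y => by
    have := h.hold _ m0 _ m1 y (y + ε * s)
    rw [add_sub_cancel_left, add_sub_cancel_left, hes, abs_of_pos hs] at this
    linarith
  have sb : ∀ y, |u (t - s) (y - ε * s) - u t y| ≤ 2 * K * s ^ θ := fun y => by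
    have := h.hold _ m0 _ m2 y (y - ε * s)
    rw [sub_sub_cancel_left, sub_sub_cancel_left, abs_neg, abs_neg, hes, abs_of_pos hs] at this
    linarith
  have ia := h.p3 ε hε t s m0.1 hs h2
  have ib : ∫ y in (0:ℝ)..1, (u (t - s) (y - ε * s) - u t y) ^ 2 ≤ K * s ^ 2 := by
    have := h.p3 ε hε (t - s) s h1 hs (by linarith)
    rw [sub_add_cancel] at this
    rw [← per_int (ψ := fun y => (u t (y + ε * s) - u (t - s) y) ^ 2) (fun y => by
      simp only [add_right_comm y 1, h.per _ m0 _, h.per _ m2 _]) (-(ε * s))] at this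
    refine le_trans (le_of_eq ?_) this
    refine intervalIntegral.integral_congr fun y _ => ?_
    simp only [neg_add_cancel_right]
    simp only [← sub_eq_add_neg]
    ring
  have fa := four_bound (by fun_prop) sa ia
  have fb := four_bound (by fun_prop) sb ib
  have i4 := h.p4 ε hε t s h1 hs h2
  have hcmp := pow_cmp hr hs (show s ≤ T by linarith)
  calc _ ≤ ∫ y in (0:ℝ)..1, (2 * L ^ 2 * (u (t + s) (y + ε * s) + u (t - s) (y - ε * s) - 2 * u t y) ^ 2
          + 4 * L ^ 2 * ((u (t + s) (y + ε * s) - u t y) ^ 4 + (u (t - s) (y - ε * s) - u t y) ^ 4)) := by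
        refine imono (by fun_prop) (by fun_prop) zero_le_one fun y _ => ?_
        exact hf.second _ _ _
    _ = 2 * L ^ 2 * (∫ y in (0:ℝ)..1, (u (t + s) (y + ε * s) + u (t - s) (y - ε * s) - 2 * u t y) ^ 2)
          + 4 * L ^ 2 * ((∫ y in (0:ℝ)..1, (u (t + s) (y + ε * s) - u t y) ^ 4)
            + ∫ y in (0:ℝ)..1, (u (t - s) (y - ε * s) - u t y) ^ 4) := by
        rw [intervalIntegral.integral_add, intervalIntegral.integral_const_mul,
          intervalIntegral.integral_const_mul, intervalIntegral.integral_add]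
        all_goals exact Continuous.intervalIntegrable (by fun_prop) _ _
    _ ≤ 2 * L ^ 2 * (K * (s ^ 2 * s ^ (2 * r))) + 4 * L ^ 2 * ((2 * K * s ^ θ) ^ 2 * (K * s ^ 2)
          + (2 * K * s ^ θ) ^ 2 * (K * s ^ 2)) := by gcongr
    _ = 2 * L ^ 2 * (K * (s ^ 2 * s ^ (2 * r))) + 32 * L ^ 2 * K ^ 3 * s ^ 2 * (s ^ θ) ^ 2 := by ring
    _ ≤ 2 * L ^ 2 * (K * (s ^ 2 * s ^ (2 * r))) + 32 * L ^ 2 * K ^ 3 * s ^ 2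
          * ((1 + T) ^ (2 * (θ - r)) * s ^ (2 * r)) := by gcongr
    _ = _ := by unfold C1; ring

lemma C1_nonneg (hK : 0 ≤ K) (hT : 0 ≤ T) : 0 ≤ C1 L K T r θ := by unfold C1; positivity

lemma EE_bound (h : Core u T r θ K) (hf : FOK f f1 L) (hθ : 0 < θ) (hr0 : 0 ≤ r) (hr : r ≤ θ) (hK : 0 ≤ K)
    {ε : ℝ} (hε : ε = 1 ∨ ε = -1) {t τ : ℝ} (h1 : 0 ≤ t - τ) (hτ : 0 < τ) (h2 : t + τ ≤ T) :
    ∫ y in (0:ℝ)..1, EE (fun t x => f (u (cl T t) x)) ε t τ y ^ 2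
      ≤ C1 L K T r θ * (τ ^ 2 * (τ ^ 2 * τ ^ (2 * r))) := by
  have hT : 0 ≤ T := by linarith
  have hw := h.ucont hθ hT
  have hfc := hf.cont
  have hg : Continuous (fun q : ℝ × ℝ => (fun t x => f (u (cl T t) x)) q.1 q.2) := hfc.comp hw
  have hC := C1_nonneg (L := L) (r := r) (θ := θ) hK hT
  generalize hgd : (fun t x => f (u (cl T t) x)) = g at hg
  have hEc := EE_cont hg ε t τ
  have hQ : Continuous (fun q : ℝ × ℝ => (g (t + q.2) (q.1 + ε * q.2) + g (t - q.2) (q.1 - ε * q.2) - 2 * g t q.1) ^ 2) := by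
    fun_prop
  have hQi : Continuous (fun y => ∫ s in (0:ℝ)..τ, (g (t + s) (y + ε * s) + g (t - s) (y - ε * s) - 2 * g t y) ^ 2) := by
    apply intervalIntegral.continuous_parametric_intervalIntegral_of_continuous'
    exact hQ
  have hQi2 : Continuous (fun s => ∫ y in (0:ℝ)..1, (g (t + s) (y + ε * s) + g (t - s) (y - ε * s) - 2 * g t y) ^ 2) := by
    apply intervalIntegral.continuous_parametric_intervalIntegral_of_continuous'
    unfold Function.uncurry; fun_prop
  calc _ ≤ ∫ y in (0:ℝ)..1, τ * ∫ s in (0:ℝ)..τ, (g (t + s) (y + ε * s) + g (t - s) (y - ε * s) - 2 * g t y) ^ 2 := by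
        refine imono (by fun_prop) (by fun_prop) zero_le_one fun y _ => ?_
        rw [EE_fold hg]
        exact cs_int (by fun_prop) hτ
    _ = τ * ∫ s in (0:ℝ)..τ, ∫ y in (0:ℝ)..1, (g (t + s) (y + ε * s) + g (t - s) (y - ε * s) - 2 * g t y) ^ 2 := by
        rw [intervalIntegral.integral_const_mul, swapr (F := fun y s => (g (t + s) (y + ε * s) + g (t - s) (y - ε * s) - 2 * g t y) ^ 2) hQ]
    _ ≤ τ * ∫ s in (0:ℝ)..τ, C1 L K T r θ * (τ ^ 2 * τ ^ (2 * r)) := by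
        refine mul_le_mul_of_nonneg_left (imono hQi2 continuous_const hτ.le fun s hs => ?_) hτ.le
        rcases hs.1.eq_or_lt with rfl | hs0
        · have : ∀ y, (g (t + 0) (y + ε * 0) + g (t - 0) (y - ε * 0) - 2 * g t y) ^ 2 = 0 := fun y => by
            simp only [add_zero, sub_zero, mul_zero]; ring
          simp only [this, intervalIntegral.integral_zero]
          positivity
        · have := Q_bound h hf hθ hr hK hε (t := t) (s := s) (by linarith [hs.2]) hs0 (by linarith [hs.2])
          subst hgd
          beta_reduce
          rw [cl_of_mem ⟨by linarith, by linarith [hs.2]⟩, cl_of_mem ⟨by linarith [hs.2], by linarith [hs.2]⟩,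
            cl_of_mem (t := t) ⟨by linarith, by linarith⟩]
          refine this.trans ?_
          have := hs.2
          gcongr
    _ = _ := by rw [intervalIntegral.integral_const, smul_eq_mul, sub_zero]; ring

lemma D1_sup (h : Core u T r θ K) (hf : FOK f f1 L) (hθ : 0 < θ) (hK : 0 ≤ K)
    {t τ : ℝ} (h1 : 0 ≤ t - τ) (hτ : 0 < τ) (h2 : t + τ ≤ T) (x : ℝ) :
    |D1 (fun t x => f (u (cl T t) x)) t τ x| ≤ 8 * L * K * (τ ^ 2 * τ ^ θ) := by
  have hT : 0 ≤ T := by linarith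
  have hL : 0 ≤ L := (abs_nonneg _).trans (hf.bd 0)
  have hw := h.ucont hθ hT
  have hfc := hf.cont
  have hg : Continuous (fun q : ℝ × ℝ => (fun t x => f (u (cl T t) x)) q.1 q.2) := hfc.comp hw
  generalize hgd : (fun t x => f (u (cl T t) x)) = g at hg
  have hA : Continuous (fun s => ∫ ζ in (-1:ℝ)..1, g (t + s) (x + (τ - s) * ζ)) := by
    apply intervalIntegral.continuous_parametric_intervalIntegral_of_continuous'
    unfold Function.uncurry; fun_prop
  unfold D1
  simp only [scaled hg]
  set A0 := ∫ ζ in (-1:ℝ)..1, g t (x + τ * ζ) with hA0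
  have e : ∀ s, (τ - s) * (∫ ζ in (-1:ℝ)..1, g (t + s) (x + (τ - s) * ζ)) / 2 - τ * A0 / 2
      = (τ - s) / 2 * ((∫ ζ in (-1:ℝ)..1, g (t + s) (x + (τ - s) * ζ)) - A0) - A0 / 2 * s := fun s => by ring
  simp only [e]
  rw [intervalIntegral.integral_sub (Continuous.intervalIntegrable (by fun_prop) _ _)
    (Continuous.intervalIntegrable (by fun_prop) _ _), intervalIntegral.integral_const_mul, integral_id]
  have : ∀ s ∈ Set.uIoc (-τ) τ, ‖(τ - s) / 2 * ((∫ ζ in (-1:ℝ)..1, g (t + s) (x + (τ - s) * ζ)) - A0)‖ ≤ τ * (4 * L * K * τ ^ θ) := by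
    intro s hs
    rw [uIoc_of_le (by linarith)] at hs
    rw [norm_mul, Real.norm_eq_abs, abs_of_nonneg (by linarith [hs.2])]
    refine mul_le_mul (by linarith [hs.1]) ?_ (norm_nonneg _) hτ.le
    rw [hA0, ← intervalIntegral.integral_sub (Continuous.intervalIntegrable (by fun_prop) _ _)
      (Continuous.intervalIntegrable (by fun_prop) _ _)]
    refine (intervalIntegral.norm_integral_le_of_norm_le_const (C := 2 * L * K * τ ^ θ) fun ζ hζ => ?_).trans ?_
    · rw [uIoc_of_le (by linarith)] at hζ
      have hsτ : |s| ≤ τ := abs_le.2 ⟨hs.1.le, hs.2⟩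
      have hζ1 : |ζ| ≤ 1 := abs_le.2 ⟨hζ.1.le, hζ.2⟩
      subst hgd
      beta_reduce
      rw [Real.norm_eq_abs, cl_of_mem (t := t) ⟨by linarith, by linarith⟩, cl_of_mem ⟨by linarith [hs.1], by linarith [hs.2]⟩]
      refine (hf.lip _ _).trans ?_
      have := h.hold t ⟨by linarith, by linarith⟩ (t + s) ⟨by linarith [hs.1], by linarith [hs.2]⟩ (x + τ * ζ) (x + (τ - s) * ζ)
      rw [show t + s - t = s by ring, show x + (τ - s) * ζ - (x + τ * ζ) = -(s * ζ) by ring, abs_neg, abs_mul] at this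
      have h3 : |s| ^ θ ≤ τ ^ θ := by gcongr
      have h4 : (|s| * |ζ|) ^ θ ≤ τ ^ θ := by
        gcongr
        exact (mul_le_of_le_one_right (abs_nonneg _) hζ1).trans hsτ
      calc L * _ ≤ L * (K * (τ ^ θ + τ ^ θ)) := by
            gcongr; exact this.trans (by gcongr)
        _ = _ := by ring
    · norm_num; linarith
  have := intervalIntegral.norm_integral_le_of_norm_le_const this
  rw [Real.norm_eq_abs, show τ - -τ = 2 * τ by ring, abs_of_pos (show 0 < 2 * τ by linarith)] at this
  rw [show A0 / 2 * ((τ ^ 2 - (-τ) ^ 2) / 2) = 0 by ring, sub_zero]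
  refine this.trans (le_of_eq ?_)
  ring

noncomputable def C2 (L K T r θ : ℝ) : ℝ := 64 * L ^ 2 * K ^ 2 * (1 + T) ^ (2 * (θ - r)) + C1 L K T r θ

lemma C2_nonneg (hK : 0 ≤ K) (hT : 0 ≤ T) : 0 ≤ C2 L K T r θ := by
  have := C1_nonneg (L := L) (r := r) (θ := θ) hK hT
  unfold C2; positivity

lemma core_concl (h : Core u T r θ K) (hf : FOK f f1 L) (hθ : 0 < θ) (hr0 : 0 ≤ r) (hr : r ≤ θ) (hK : 0 ≤ K)
    {t τ : ℝ} (h1 : 0 ≤ t - τ) (hτ : 0 < τ) (h2 : t + τ ≤ T) :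
    (∑' k, jj k ^ (2 * (1:ℝ)) * ‖co (D1 (fun t x => f (u (cl T t) x)) t τ) k‖ ^ 2)
      + (∑' k, jj k ^ (2 * (0:ℝ)) * ‖co (D2 (fun t x => f (u (cl T t) x)) t τ) k‖ ^ 2)
      ≤ C2 L K T r θ * (τ ^ 2 * (τ ^ 2 * τ ^ (2 * r))) := by
  have hT : 0 ≤ T := by linarith
  have hw := h.ucont hθ hT
  have hfc := hf.cont
  have hg : Continuous (fun q : ℝ × ℝ => (fun t x => f (u (cl T t) x)) q.1 q.2) := hfc.comp hw
  have hgp : ∀ t, Function.Periodic ((fun t x => f (u (cl T t) x)) t) 1 := fun t x => by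
    simp only [h.per _ (cl_mem hT t) x]
  have hD1 := D1_sup h hf hθ hK h1 hτ h2
  have hE1 := EE_bound h hf hθ hr0 hr hK (Or.inl rfl) h1 hτ h2
  have hE2 := EE_bound h hf hθ hr0 hr hK (Or.inr rfl) h1 hτ h2
  have hcmp := pow_cmp hr hτ (show τ ≤ T by linarith)
  generalize (fun t x => f (u (cl T t) x)) = g at hg hgp hD1 hE1 hE2 ⊢
  have hper : Function.Periodic (D1 g t τ) 1 := fun x => by
    unfold D1
    simp only [add_right_comm x 1, hgp _ _]
  have hEp : ∀ ε, Function.Periodic (fun y => EE g ε t τ y ^ 2) 1 := fun ε y => by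
    unfold EE
    simp only [add_right_comm y 1, hgp _ _]
  have cE1 := EE_cont hg 1 t τ
  have cE2 := EE_cont hg (-1) t τ
  have cD1 : Continuous (D1 g t τ) := continuous_iff_continuousAt.2 fun x => (D1_deriv hg t τ x).continuousAt
  have cP1 : Continuous (P1 g t τ) := by rw [funext (P1_eq hg t τ)]; fun_prop
  have cD2 : Continuous (D2 g t τ) := by rw [funext (D2_eq hg t τ)]; fun_prop
  have b1 := h1_bound (D1_deriv hg t τ) cP1 hper
  have b0 := h0_bound cD2
  have i1 : ∫ x in (0:ℝ)..1, D1 g t τ x ^ 2 ≤ 64 * L ^ 2 * K ^ 2 * (1 + T) ^ (2 * (θ - r)) * (τ ^ 2 * (τ ^ 2 * τ ^ (2 * r))) := by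
    calc _ ≤ ∫ x in (0:ℝ)..1, (8 * L * K * (τ ^ 2 * τ ^ θ)) ^ 2 := by
          refine imono (by fun_prop) continuous_const zero_le_one fun x _ => ?_
          rw [← sq_abs]; gcongr; exact hD1 x
      _ = 64 * L ^ 2 * K ^ 2 * (τ ^ 2 * τ ^ 2) * (τ ^ θ) ^ 2 := by
          rw [intervalIntegral.integral_const, smul_eq_mul]; ring
      _ ≤ 64 * L ^ 2 * K ^ 2 * (τ ^ 2 * τ ^ 2) * ((1 + T) ^ (2 * (θ - r)) * τ ^ (2 * r)) := by gcongr
      _ = _ := by ring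
  have i2 : (∫ x in (0:ℝ)..1, P1 g t τ x ^ 2) + ∫ x in (0:ℝ)..1, D2 g t τ x ^ 2
      = (∫ y in (0:ℝ)..1, EE g (-1) t τ y ^ 2) / 2 + (∫ y in (0:ℝ)..1, EE g 1 t τ y ^ 2) / 2 := by
    rw [← per_int (hEp (-1)) τ, ← per_int (hEp 1) (-τ), ← intervalIntegral.integral_add,
      ← intervalIntegral.integral_div, ← intervalIntegral.integral_div, ← intervalIntegral.integral_add]
    · refine intervalIntegral.integral_congr fun x _ => ?_
      beta_reduce
      rw [P1_eq hg, D2_eq hg, ← sub_eq_add_neg]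
      ring
    all_goals exact Continuous.intervalIntegrable (by fun_prop) _ _
  unfold C2
  rw [add_mul]
  linarith

end conc

lemma HB.mono {α β B : ℝ} {φ : ℝ → ℝ} (h : HB α φ B) (hβ : β ≤ α) : HB β φ B := by
  have hle : ∀ k, jj k ^ (2 * β) * ‖co φ k‖ ^ 2 ≤ jj k ^ (2 * α) * ‖co φ k‖ ^ 2 := fun k => by
    gcongr
    exact jj_one k
  have hs : Summable (fun k => jj k ^ (2 * β) * ‖co φ k‖ ^ 2) :=
    Summable.of_nonneg_of_le (fun k => by have := jj_pos k; positivity) hle h.1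
  exact ⟨hs, (hs.tsum_le_tsum hle h.1).trans h.2⟩

structure Wave (u v : ℝ → ℝ → ℝ) (T r B M : ℝ) : Prop where
  cu : ∀ t ∈ Icc (0:ℝ) T, Continuous (u t)
  pu : ∀ t ∈ Icc (0:ℝ) T, Function.Periodic (u t) 1
  hu : ∀ t ∈ Icc (0:ℝ) T, HB (1 + r) (u t) B
  cv : ∀ t ∈ Icc (0:ℝ) T, Continuous (v t)
  pv : ∀ t ∈ Icc (0:ℝ) T, Function.Periodic (v t) 1
  hv : ∀ t ∈ Icc (0:ℝ) T, HB r (v t) B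
  mild : ∀ t s, 0 ≤ t → 0 ≤ s → t + s ≤ T → ∀ x,
    |u (t + s) x - ((u t (x + s) + u t (x - s)) / 2 + JJ (v t) (2 * s) (x - s) / 2)| ≤ M * s ^ 2

lemma sq3 {q a b : ℝ → ℝ} (hq : Continuous q) (ha : Continuous a) (hb : Continuous b) {A B R : ℝ}
    (hR : ∀ y, |q y - (a y + b y)| ≤ R) (hA : ∫ y in (0:ℝ)..1, a y ^ 2 ≤ A) (hB : ∫ y in (0:ℝ)..1, b y ^ 2 ≤ B) :
    ∫ y in (0:ℝ)..1, q y ^ 2 ≤ 3 * (A + B + R ^ 2) := by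
  calc _ ≤ ∫ y in (0:ℝ)..1, 3 * (a y ^ 2 + b y ^ 2 + R ^ 2) := by
        refine imono (by fun_prop) (by fun_prop) zero_le_one fun y _ => ?_
        have : (q y - (a y + b y)) ^ 2 ≤ R ^ 2 := by rw [← sq_abs]; gcongr; exact hR y
        nlinarith [sq_nonneg (a y - b y), sq_nonneg (a y - (q y - (a y + b y))), sq_nonneg (b y - (q y - (a y + b y)))]
    _ = 3 * ((∫ y in (0:ℝ)..1, a y ^ 2) + (∫ y in (0:ℝ)..1, b y ^ 2) + R ^ 2) := by
        rw [intervalIntegral.integral_const_mul, intervalIntegral.integral_add, intervalIntegral.integral_add,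
          intervalIntegral.integral_const, smul_eq_mul, sub_zero, one_mul]
        all_goals exact Continuous.intervalIntegrable (by fun_prop) _ _
    _ ≤ _ := by linarith

lemma JJ_add {φ : ℝ → ℝ} (hc : Continuous φ) (h x : ℝ) : JJ φ (2 * h) x = JJ φ h x + JJ φ h (x + h) := by
  unfold JJ
  have e : ∫ z in (0:ℝ)..h, φ (x + h + z) = ∫ z in h..(2 * h), φ (x + z) := by
    have := intervalIntegral.integral_comp_add_right (a := 0) (b := h) (fun z => φ (x + z)) h
    rw [zero_add, ← two_mul] at this
    rw [← this]
    refine intervalIntegral.integral_congr fun z _ => ?_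
    beta_reduce
    congr 1; ring
  rw [e, intervalIntegral.integral_add_adjacent_intervals]
  all_goals exact Continuous.intervalIntegrable (by fun_prop) _ _

section wave
variable {u v : ℝ → ℝ → ℝ} {T r B M : ℝ}

lemma two_rpow_le {s θ : ℝ} (hs : 0 ≤ s) (h1 : θ ≤ 1) : (2 * s) ^ θ ≤ 2 * s ^ θ := by
  rw [Real.mul_rpow (by norm_num) hs]
  gcongr
  calc (2:ℝ) ^ θ ≤ 2 ^ (1:ℝ) := Real.rpow_le_rpow_of_exponent_le (by norm_num) h1
    _ = 2 := by norm_num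

lemma sq_le_rpow {s θ T : ℝ} (hs : 0 ≤ s) (hsT : s ≤ T) (h0 : 0 < θ) (h1 : θ ≤ 1) : s ^ 2 ≤ (1 + T) ^ 2 * s ^ θ := by
  rcases hs.eq_or_lt with rfl | hs
  · rw [Real.zero_rpow h0.ne']; simp
  · have e : s ^ 2 = s ^ (2 - θ) * s ^ θ := by
      rw [← Real.rpow_add hs]; norm_num
    rw [e]
    have : s ^ (2 - θ) ≤ (1 + T) ^ 2 := by
      calc s ^ (2 - θ) ≤ (1 + T) ^ (2 - θ) := by gcongr <;> linarith
        _ ≤ (1 + T) ^ (2:ℝ) := Real.rpow_le_rpow_of_exponent_le (by linarith) (by linarith)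
        _ = _ := by norm_num
    gcongr

noncomputable def K1 (B M T : ℝ) : ℝ := (4 * Real.pi + (1 + 2 * T)) * (ZZ + B) + M * (1 + T) ^ 2

lemma time_hold (h : Wave u v T r B M) (hM : 0 ≤ M) {θ : ℝ} (h0 : 0 < θ) (h1 : θ ≤ 1) (hθ : θ ≤ r + 1/4)
    {t s : ℝ} (ht : 0 ≤ t) (hs : 0 ≤ s) (hT : t + s ≤ T) (x : ℝ) : |u (t + s) x - u t x| ≤ K1 B M T * s ^ θ := by
  have m : t ∈ Icc (0:ℝ) T := ⟨ht, by linarith⟩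
  have hB := (h.hu t m).nonneg
  have hZ := ZZ_nonneg
  have hm := h.mild t s ht hs hT x
  have a1 := diff_sup (h.cu t m) (h.pu t m) (h.hu t m) h0.le h1 hθ s x
  have a2 := diff_sup (h.cu t m) (h.pu t m) (h.hu t m) h0.le h1 hθ (-s) x
  have a3 := JJ_sup (h.cv t m) (h.pv t m) (h.hv t m) h0.le h1 hθ (h := 2 * s) (H := 2 * T)
    (by rw [abs_of_nonneg (by linarith)]; linarith) (x - s)
  have a4 := two_rpow_le hs h1
  have a5 := sq_le_rpow hs (show s ≤ T by linarith) h0 h1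
  rw [abs_neg, abs_of_nonneg hs, ← sub_eq_add_neg] at a2
  rw [abs_of_nonneg hs] at a1
  rw [abs_of_nonneg (show 0 ≤ 2 * s by linarith)] at a3
  have a6 : (1 + 2 * T) * (2 * s) ^ θ * (ZZ + B) ≤ (1 + 2 * T) * (2 * s ^ θ) * (ZZ + B) := by
    have : 0 ≤ 1 + 2 * T := by linarith
    gcongr
  have a7 : M * s ^ 2 ≤ M * ((1 + T) ^ 2 * s ^ θ) := by gcongr
  have a8 : K1 B M T * s ^ θ = (4 * Real.pi * s ^ θ * (ZZ + B)) + ((1 + 2 * T) * (2 * s ^ θ) * (ZZ + B)) / 2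
      + M * ((1 + T) ^ 2 * s ^ θ) := by unfold K1; ring
  rw [a8]
  rw [abs_le] at *
  constructor <;> linarith [a1.1, a1.2, a2.1, a2.2, a3.1, a3.2, hm.1, hm.2]

lemma K1_ge (hB : 0 ≤ B) (hM : 0 ≤ M) (hT : 0 ≤ T) : 4 * Real.pi * (ZZ + B) ≤ K1 B M T := by
  have hZ := ZZ_nonneg
  have : 0 ≤ (1 + 2 * T) * (ZZ + B) + M * (1 + T) ^ 2 := by positivity
  unfold K1; linarith

lemma wave_hold (h : Wave u v T r B M) (hM : 0 ≤ M) {θ : ℝ} (h0 : 0 < θ) (h1 : θ ≤ 1) (hθ : θ ≤ r + 1/4)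
    (t : ℝ) (ht : t ∈ Icc (0:ℝ) T) (t' : ℝ) (ht' : t' ∈ Icc (0:ℝ) T) (x x' : ℝ) :
    |u t' x' - u t x| ≤ K1 B M T * (|t' - t| ^ θ + |x' - x| ^ θ) := by
  have hB := (h.hu t ht).nonneg
  have hT : 0 ≤ T := ht.1.trans ht.2
  have a1 : |u t x' - u t x| ≤ K1 B M T * |x' - x| ^ θ := by
    have := diff_sup (h.cu t ht) (h.pu t ht) (h.hu t ht) h0.le h1 hθ (x' - x) x
    rw [add_sub_cancel] at this
    refine this.trans ?_
    have := mul_le_mul_of_nonneg_right (K1_ge hB hM hT) (Real.rpow_nonneg (abs_nonneg (x' - x)) θ)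
    linarith
  have a2 : |u t' x' - u t x'| ≤ K1 B M T * |t' - t| ^ θ := by
    rcases le_total t t' with hle | hle
    · have := time_hold h hM h0 h1 hθ ht.1 (sub_nonneg.2 hle) (by linarith [ht'.2]) x'
      rwa [add_sub_cancel, ← abs_of_nonneg (sub_nonneg.2 hle)] at this
    · have := time_hold h hM h0 h1 hθ ht'.1 (sub_nonneg.2 hle) (by linarith [ht.2]) x'
      rwa [add_sub_cancel, ← abs_of_nonneg (sub_nonneg.2 hle), abs_sub_comm, abs_sub_comm t t'] at this
  have := abs_add_le (u t' x' - u t x') (u t x' - u t x)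
  rw [sub_add_sub_cancel] at this
  linarith

lemma wave_p3 (h : Wave u v T r B M) (hr0 : 0 ≤ r) (ε : ℝ) (hε : ε = 1 ∨ ε = -1) (t s : ℝ) (ht : 0 ≤ t)
    (hs : 0 < s) (hT : t + s ≤ T) :
    ∫ y in (0:ℝ)..1, (u (t + s) (y + ε * s) - u t y) ^ 2 ≤ 3 * (4 * Real.pi ^ 2 * B + B + M ^ 2 * T ^ 2) * s ^ 2 := by
  have m : t ∈ Icc (0:ℝ) T := ⟨ht, by linarith⟩
  have m1 : t + s ∈ Icc (0:ℝ) T := ⟨by linarith, hT⟩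
  have c1 := h.cu _ m1
  have c0 := h.cu _ m
  have cJ := JJ_cont (h.cv _ m) (2 * s)
  have h1 : HB 1 (u t) B := (h.hu t m).mono (by linarith)
  have h0 : HB 0 (v t) B := (h.hv t m).mono hr0
  have habs : |2 * ε * s| = 2 * s := by
    rcases hε with rfl | rfl
    · rw [abs_of_pos] <;> linarith
    · rw [show 2 * -1 * s = -(2 * s) by ring, abs_neg, abs_of_pos]; linarith
  have iA : ∫ y in (0:ℝ)..1, ((u t (y + 2 * ε * s) - u t y) / 2) ^ 2 ≤ 4 * Real.pi ^ 2 * B * s ^ 2 := by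
    have := diff_l2 c0 (h.pu t m) h1 (2 * ε * s)
    simp only [div_pow]
    rw [intervalIntegral.integral_div]
    rw [habs] at this
    linarith
  have iB : ∫ y in (0:ℝ)..1, (JJ (v t) (2 * s) (y + (ε * s - s)) / 2) ^ 2 ≤ B * s ^ 2 := by
    have := JJ_l2 (h.cv t m) (h.pv t m) h0 (2 * s)
    rw [← per_int (ψ := fun y => JJ (v t) (2 * s) y ^ 2) (fun y => by simp only [JJ_per (h.pv t m) (2 * s) y]) (ε * s - s),
      abs_of_pos (show 0 < 2 * s by linarith)] at this
    simp only [div_pow]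
    rw [intervalIntegral.integral_div]
    linarith
  have hs2 : s ^ 2 ≤ T ^ 2 := by gcongr; linarith
  refine (sq3 (R := M * s ^ 2) (by fun_prop) (by fun_prop) (by fun_prop) (fun y => ?_) iA iB).trans ?_
  · have := h.mild t s ht hs.le hT (y + ε * s)
    convert this using 2
    rcases hε with rfl | rfl
    · rw [show y + 1 * s + s = y + 2 * 1 * s by ring, show y + 1 * s - s = y by ring,
        show y + (1 * s - s) = y by ring]
      ring
    · rw [show y + -1 * s + s = y by ring, show y + -1 * s - s = y + 2 * -1 * s by ring,
        show y + (-1 * s - s) = y + 2 * -1 * s by ring]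
      ring
  · nlinarith [mul_le_mul_of_nonneg_left hs2 (show 0 ≤ M ^ 2 * s ^ 2 by positivity)]

lemma wave_I1 (h : Wave u v T r B M) {t s : ℝ} (ht : 0 ≤ t - s) (hs : 0 < s) (hT : t + s ≤ T) (x : ℝ) :
    |u (t + s) x + u (t - s) x - u t (x + s) - u t (x - s)| ≤ 6 * M * s ^ 2 := by
  have m : t - s ∈ Icc (0:ℝ) T := ⟨ht, by linarith⟩
  have a1 := h.mild (t - s) (2 * s) ht (by linarith) (by linarith) x
  have a2 := h.mild (t - s) s ht hs.le (by linarith) (x + s)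
  have a3 := h.mild (t - s) s ht hs.le (by linarith) (x - s)
  rw [JJ_add (h.cv _ m), show t - s + 2 * s = t + s by ring, show x - 2 * s + 2 * s = x by ring] at a1
  rw [show t - s + s = t by ring, show x + s + s = x + 2 * s by ring, show x + s - s = x by ring] at a2
  rw [show t - s + s = t by ring, show x - s + s = x by ring, show x - s - s = x - 2 * s by ring] at a3
  rw [abs_le] at *
  constructor <;> nlinarith [a1.1, a1.2, a2.1, a2.2, a3.1, a3.2]

noncomputable def K4 (B M T r : ℝ) : ℝ :=
  3 * (1024 * Real.pi ^ 4 * B + 64 * Real.pi ^ 2 * B + 64 * M ^ 2 * (1 + T) ^ (2 * (1 - r)))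

lemma wave_p4 (h : Wave u v T r B M) (hr0 : 0 ≤ r) (hr1 : r ≤ 1) (ε : ℝ) (hε : ε = 1 ∨ ε = -1) (t s : ℝ) (ht : 0 ≤ t - s)
    (hs : 0 < s) (hT : t + s ≤ T) :
    ∫ y in (0:ℝ)..1, (u (t + s) (y + ε * s) + u (t - s) (y - ε * s) - 2 * u t y) ^ 2
      ≤ K4 B M T r * (s ^ 2 * s ^ (2 * r)) := by
  have m : t ∈ Icc (0:ℝ) T := ⟨by linarith, by linarith⟩
  have m1 : t + s ∈ Icc (0:ℝ) T := ⟨by linarith, hT⟩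
  have m2 : t - s ∈ Icc (0:ℝ) T := ⟨ht, by linarith⟩
  have c1 := h.cu _ m1
  have c2 := h.cu _ m2
  have c0 := h.cu _ m
  have hB := (h.hu t m).nonneg
  have cJ := JJ_cont (h.cv _ m) (2 * s)
  have hp := two_rpow_le hs.le hr1
  have e2 : (s ^ r) ^ 2 = s ^ (2 * r) := by
    rw [← Real.rpow_natCast, ← Real.rpow_mul hs.le, mul_comm]; norm_num
  have hp2 : ((2 * s) ^ r) ^ 2 ≤ 4 * s ^ (2 * r) := by
    calc ((2 * s) ^ r) ^ 2 ≤ (2 * s ^ r) ^ 2 := by gcongr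
      _ = _ := by rw [mul_pow, e2]; norm_num
  have iA : ∫ y in (0:ℝ)..1, ((u t (y + 2 * s) - 2 * u t y + u t (y - 2 * s)) / 2) ^ 2
      ≤ 1024 * Real.pi ^ 4 * B * (s ^ 2 * s ^ (2 * r)) := by
    have := diff2_l2 c0 (h.pu t m) hr0 hr1 (h.hu t m) (2 * s)
    simp only [div_pow]
    rw [intervalIntegral.integral_div]
    rw [abs_of_pos (show 0 < 2 * s by linarith)] at this
    have h3 : ((4 * Real.pi) ^ 2 * (2 * s * (2 * s) ^ r)) ^ 2 * B ≤ (1024 * Real.pi ^ 4 * B * s ^ 2) * (4 * s ^ (2 * r)) := by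
      calc _ = (1024 * Real.pi ^ 4 * B * s ^ 2) * ((2 * s) ^ r) ^ 2 := by ring
        _ ≤ _ := by gcongr
    linarith
  have iB : ∫ y in (0:ℝ)..1, (-ε * (JJ (v t) (2 * s) (y + -(2 * s)) - JJ (v t) (2 * s) y) / 2) ^ 2
      ≤ 64 * Real.pi ^ 2 * B * (s ^ 2 * s ^ (2 * r)) := by
    have := JJ2_l2 (h.cv t m) (h.pv t m) hr0 hr1 (h.hv t m) (2 * s)
    have hε2 : (-ε) ^ 2 = 1 := by rcases hε with rfl | rfl <;> norm_num
    simp only [div_pow, mul_pow, hε2, one_mul]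
    rw [intervalIntegral.integral_div]
    rw [abs_of_pos (show 0 < 2 * s by linarith)] at this
    have h3 : (4 * Real.pi * (2 * s * (2 * s) ^ r)) ^ 2 * B ≤ (64 * Real.pi ^ 2 * B * s ^ 2) * (4 * s ^ (2 * r)) := by
      calc _ = (64 * Real.pi ^ 2 * B * s ^ 2) * ((2 * s) ^ r) ^ 2 := by ring
        _ ≤ _ := by gcongr
    linarith
  have hcmp := pow_cmp (θ := 1) hr1 hs (show s ≤ T by linarith)
  rw [Real.rpow_one] at hcmp
  refine (sq3 (R := 8 * M * s ^ 2) (by fun_prop) (by fun_prop) (by fun_prop) (fun y => ?_) iA iB).trans ?_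
  · have b1 := h.mild t s (by linarith) hs.le hT (y + s)
    have b2 := h.mild t s (by linarith) hs.le hT (y - s)
    rw [show y + s + s = y + 2 * s by ring, show y + s - s = y by ring] at b1
    rw [show y - s + s = y by ring, show y - s - s = y - 2 * s by ring] at b2
    rcases hε with rfl | rfl
    · have b3 := wave_I1 h ht hs hT (y - s)
      rw [show y - s + s = y by ring, show y - s - s = y - 2 * s by ring] at b3
      rw [one_mul, ← sub_eq_add_neg]
      rw [abs_le] at *
      constructor <;> linarith [b1.1, b1.2, b2.1, b2.2, b3.1, b3.2]
    · have b3 := wave_I1 h ht hs hT (y + s)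
      rw [show y + s + s = y + 2 * s by ring, show y + s - s = y by ring] at b3
      rw [← sub_eq_add_neg, show y + -1 * s = y - s by ring, show y - -1 * s = y + s by ring]
      rw [abs_le] at *
      constructor <;> linarith [b1.1, b1.2, b2.1, b2.2, b3.1, b3.2]
  · have := mul_le_mul_of_nonneg_left hcmp (show 0 ≤ 192 * M ^ 2 * s ^ 2 by positivity)
    unfold K4
    nlinarith

lemma wave_core (h : Wave u v T r B M) (hB : 0 ≤ B) (hM : 0 ≤ M) (hT : 0 ≤ T) (hr0 : 0 ≤ r) (hr1 : r ≤ 1)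
    {θ : ℝ} (h0 : 0 < θ) (h1 : θ ≤ 1) (hθ : θ ≤ r + 1/4) : ∃ K, 0 ≤ K ∧ Core u T r θ K := by
  have hZ := ZZ_nonneg
  have p1 : 0 ≤ K1 B M T := le_trans (by positivity) (K1_ge hB hM hT)
  have p3 : 0 ≤ 3 * (4 * Real.pi ^ 2 * B + B + M ^ 2 * T ^ 2) := by positivity
  have p4 : 0 ≤ K4 B M T r := by unfold K4; positivity
  refine ⟨K1 B M T + 3 * (4 * Real.pi ^ 2 * B + B + M ^ 2 * T ^ 2) + K4 B M T r, by positivity, h.pu, ?_, ?_, ?_⟩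
  · intro t ht t' ht' x x'
    refine (wave_hold h hM h0 h1 hθ t ht t' ht' x x').trans ?_
    gcongr
    linarith
  · intro ε hε t s ht hs hts
    refine (wave_p3 h hr0 ε hε t s ht hs hts).trans ?_
    gcongr
    linarith
  · intro ε hε t s ht hs hts
    refine (wave_p4 h hr0 hr1 ε hε t s ht hs hts).trans ?_
    gcongr
    linarith

end wave

lemma fok_of {f : ℝ → ℝ} {L : ℝ} (hf : ContDiff ℝ 2 f)
    (hf1 : ∀ x : ℝ, |deriv f x| ≤ L) (hf2 : ∀ x : ℝ, |deriv (deriv f) x| ≤ L) : FOK f (deriv f) L := by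
  have hd : Differentiable ℝ f := hf.differentiable (by norm_num)
  have hd2 : Differentiable ℝ (deriv f) := by
    have : ContDiff ℝ (1 + 1) f := by norm_num; exact hf
    exact ((contDiff_succ_iff_deriv.1 this).2.2).differentiable (by norm_num)
  have lip : ∀ {g : ℝ → ℝ} {C : ℝ}, Differentiable ℝ g → (∀ x, |deriv g x| ≤ C) → ∀ a b, |g a - g b| ≤ C * |a - b| := by
    intro g C hg hC a b
    exact convex_univ.norm_image_sub_le_of_norm_deriv_le (fun x _ => hg x) (fun x _ => hC x) (mem_univ b) (mem_univ a)
  refine ⟨hd.continuous, lip hd hf1, hf1, ?_⟩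
  intro w a
  have key := (convex_uIcc w (w + a)).norm_image_sub_le_of_norm_hasDerivWithin_le
    (f := fun x => f x - deriv f w * x) (f' := fun x => deriv f x - deriv f w) (C := L * |a|)
    (fun x _ => by
      have h1 := (hd x).hasDerivAt.sub ((hasDerivAt_id x).const_mul (deriv f w))
      rw [mul_one] at h1
      exact h1.hasDerivWithinAt)
    (fun x hx => by
      refine (lip hd2 hf2 x w).trans ?_
      have hL : 0 ≤ L := (abs_nonneg _).trans (hf1 0)
      refine mul_le_mul_of_nonneg_left ?_ hL
      have := abs_sub_left_of_mem_uIcc hx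
      rwa [add_sub_cancel_left] at this)
    left_mem_uIcc right_mem_uIcc
  rw [Real.norm_eq_abs, Real.norm_eq_abs, add_sub_cancel_left, mul_assoc, abs_mul_abs_self] at key
  rw [pow_two]
  convert key using 2
  ring

lemma sym_JJ (φ : ℝ → ℝ) (s x : ℝ) : ∫ z in (-s)..s, φ (x + z) = JJ φ (2 * s) (x - s) := by
  unfold JJ
  have := intervalIntegral.integral_comp_add_right (a := 0) (b := 2 * s) (fun z => φ (x + z)) (-s)
  rw [show 0 + -s = -s by ring, show 2 * s + -s = s by ring] at this
  rw [← this]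
  refine intervalIntegral.integral_congr fun z _ => ?_
  beta_reduce
  congr 1; ring

lemma mild_nice {f : ℝ → ℝ} {T : ℝ} {U : ℝ → Pair 1} (hmild : IsMild f T U) {t : ℝ} (ht : t ∈ Icc (0:ℝ) T) :
    Nice (sec (U t).1) ∧ Nice (sec (U t).2) := by
  apply nice_of_fix
  have h := hmild t 0 ht.1 le_rfl (by linarith [ht.2])
  rw [add_zero] at h
  have e : (pInt 0 0 fun σ => expL (0 - σ) (Fnl f (U (t + σ)))) = 0 := by
    unfold pInt
    simp only [intervalIntegral.integral_same]
    rfl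
  rw [e, add_zero] at h
  exact h

lemma mild_wave {f f1 : ℝ → ℝ} {L T r : ℝ} (hf : FOK f f1 L) (hr0 : 0 ≤ r)
    {U : ℝ → Pair 1} (hmild : IsMild f T U)
    (hreg : ∀ t ∈ Set.Icc (0:ℝ) T, PMem (1+r) (U t)) {B : ℝ}
    (hbdd : ∀ t ∈ Set.Icc (0:ℝ) T, pnorm (1+r) (U t) ≤ B) :
    Wave (fun t => sec (U t).1) (fun t => sec (U t).2) T r (B ^ 2) (|f 0| + L * (ZZ + B ^ 2)) := by
  have hL : 0 ≤ L := (abs_nonneg _).trans (hf.bd 0)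
  have hsum : ∀ t ∈ Set.Icc (0:ℝ) T, sob (1+r) (U t).1 ^ 2 + sob r (U t).2 ^ 2 ≤ B ^ 2 := fun t ht => by
    have h := hbdd t ht
    unfold pnorm at h
    have h2 := (Real.sqrt_le_iff.1 h).2
    rwa [add_sub_cancel_left] at h2
  have hu : ∀ t ∈ Icc (0:ℝ) T, HB (1 + r) (sec (U t).1) (B ^ 2) := fun t ht =>
    HB_of (hreg t ht).1 (by nlinarith [hsum t ht, sq_nonneg (sob r (U t).2)])
  have hv : ∀ t ∈ Icc (0:ℝ) T, HB r (sec (U t).2) (B ^ 2) := fun t ht => by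
    have h1 := (hreg t ht).2
    rw [add_sub_cancel_left] at h1
    exact HB_of h1 (by nlinarith [hsum t ht, sq_nonneg (sob (1+r) (U t).1)])
  have hn := fun t (ht : t ∈ Icc (0:ℝ) T) => mild_nice hmild ht
  have hM : ∀ t ∈ Icc (0:ℝ) T, ∀ x, |f (sec (U t).1 x)| ≤ |f 0| + L * (ZZ + B ^ 2) := by
    intro t ht x
    have h1 := supmult (β := 0) (A := 1) (hu t ht) (by linarith) zero_le_one (hn t ht).1.cont (hn t ht).1.per
      (fun k => by simp) x
    have h2 := hf.lip (sec (U t).1 x) 0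
    rw [sub_zero] at h2
    have h3 : L * |sec (U t).1 x| ≤ L * (ZZ + B ^ 2) := by gcongr; linarith
    have h4 := abs_add_le (f (sec (U t).1 x) - f 0) (f 0)
    rw [sub_add_cancel] at h4
    linarith
  refine ⟨fun t ht => (hn t ht).1.cont, fun t ht => (hn t ht).1.per, hu, fun t ht => (hn t ht).2.cont,
    fun t ht => (hn t ht).2.per, hv, ?_⟩
  intro t s ht hs hT x
  set M := |f 0| + L * (ZZ + B ^ 2)
  have hM0 : 0 ≤ M := by have := ZZ_nonneg; positivity
  have m : t ∈ Icc (0:ℝ) T := ⟨ht, by linarith⟩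
  have e : (U (t + s)).1 (fun _ => x) = (expL s (U t)).1 (fun _ => x)
      + ∫ σ in (0:ℝ)..s, (expL (s - σ) (Fnl f (U (t + σ)))).1 (fun _ => x) := by
    rw [hmild t s ht hs hT]; rfl
  rw [expL_fst (hn t m).1 (hn t m).2, sym_JJ (sec (U t).2)] at e
  show |(U (t + s)).1 (fun _ => x) - _| ≤ _
  rw [e, add_sub_cancel_left]
  have := intervalIntegral.norm_integral_le_of_norm_le_const (a := 0) (b := s) (C := M * s)
    (f := fun σ => (expL (s - σ) (Fnl f (U (t + σ)))).1 (fun _ => x)) (fun σ hσ => by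
      rw [uIoc_of_le hs] at hσ
      have mσ : t + σ ∈ Icc (0:ℝ) T := ⟨by linarith [hσ.1], by linarith [hσ.2]⟩
      have hB1 : HB 1 (sec (U (t + σ)).1) (B ^ 2) := (hu _ mσ).mono (by linarith)
      rw [expL_F_fst (comp_nice (hn _ mσ).1.cont (hn _ mσ).1.per hB1 hf.lip hf.cont)]
      have h1 := intervalIntegral.norm_integral_le_of_norm_le_const (a := -(s - σ)) (b := s - σ) (C := M)
        (f := fun z => f (sec (U (t + σ)).1 (x + z))) (fun z _ => hM _ mσ _)
      rw [show s - σ - -(s - σ) = 2 * (s - σ) by ring, abs_of_nonneg (by linarith [hσ.2])] at h1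
      rw [norm_div, Real.norm_ofNat]
      nlinarith [hσ.1])
  rw [sub_zero, abs_of_nonneg hs, Real.norm_eq_abs] at this
  linarith

lemma defect_eq {f f1 : ℝ → ℝ} {L T r θ K : ℝ} (hf : FOK f f1 L) (hT0 : 0 ≤ T) {U : ℝ → Pair 1} (hmild : IsMild f T U)
    (hcomp : ∀ t ∈ Icc (0:ℝ) T, Nice (fun x => f (sec (U t).1 x)))
    (hcore : Core (fun t => sec (U t).1) T r θ K) (hθ : 0 < θ)
    {t τ : ℝ} (h1 : 0 ≤ t - τ) (hτ : 0 < τ) (h2 : t + τ ≤ T) (W : Pair 1)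
    (hW : W = U (t + τ) - expL (2*τ) (U (t - τ)) - (2*τ) • expL τ (Fnl f (U t))) :
    sec W.1 = D1 (fun t x => f (sec (U (cl T t)).1 x)) t τ ∧
    sec W.2 = D2 (fun t x => f (sec (U (cl T t)).1 x)) t τ := by
  have hw := hcore.ucont hθ hT0
  have hfc := hf.cont
  have hg : Continuous (fun q : ℝ × ℝ => (fun t x => f (sec (U (cl T t)).1 x)) q.1 q.2) := hfc.comp hw
  have hm := hmild (t - τ) (2 * τ) h1 (by linarith) (by linarith)
  rw [show t - τ + 2 * τ = t + τ by ring] at hm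
  rw [hm] at hW
  have m0 : t ∈ Icc (0:ℝ) T := ⟨by linarith, by linarith⟩
  have hcl : ∀ s ∈ Set.uIcc (-τ) τ, cl T (t + s) = t + s := fun s hs => by
    rw [uIcc_of_le (by linarith)] at hs
    exact cl_of_mem ⟨by linarith [hs.1], by linarith [hs.2]⟩
  have hmem : ∀ s ∈ Set.uIcc (-τ) τ, t + s ∈ Icc (0:ℝ) T := fun s hs => by
    rw [uIcc_of_le (by linarith)] at hs
    exact ⟨by linarith [hs.1], by linarith [hs.2]⟩
  have shift : ∀ G : ℝ → ℝ, ∫ σ in (0:ℝ)..(2 * τ), G σ = ∫ s in (-τ)..τ, G (s + τ) := fun G => by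
    rw [intervalIntegral.integral_comp_add_right]
    congr 1 <;> ring
  generalize hgd : (fun t x => f (sec (U (cl T t)).1 x)) = g at hg
  have hgm : ∀ s ∈ Set.uIcc (-τ) τ, ∀ x, f (sec (U (t + s)).1 x) = g (t + s) x := fun s hs x => by
    rw [← hgd]; simp only [hcl s hs]
  have hg0 : ∀ x, f (sec (U t).1 x) = g t x := fun x => by
    rw [← hgd]; simp only [cl_of_mem m0]
  constructor
  · ext x
    have e : sec W.1 x = (∫ σ in (0:ℝ)..(2 * τ), (expL (2 * τ - σ) (Fnl f (U (t - τ + σ)))).1 (fun _ => x))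
        - 2 * τ * (expL τ (Fnl f (U t))).1 (fun _ => x) := by
      rw [hW, add_sub_cancel_left]; rfl
    rw [e, shift, expL_F_fst (hcomp t m0)]
    have hA : Continuous (fun s => (∫ z in (-(τ - s))..(τ - s), g (t + s) (x + z)) / 2) := by
      simp only [scaled hg]
      have h1 := (scaled_cont hg).comp (g := fun q : ℝ × ℝ × ℝ => q.1 * ∫ ζ in (-1:ℝ)..1, g q.2.1 (q.2.2 + q.1 * ζ)) (f := fun s : ℝ => (τ - s, t + s, x)) (by fun_prop)
      exact h1.div_const 2
    unfold D1
    rw [intervalIntegral.integral_sub (hA.intervalIntegrable _ _) (continuous_const.intervalIntegrable _ _),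
      intervalIntegral.integral_const, smul_eq_mul]
    congr 1
    · refine intervalIntegral.integral_congr fun s hs => ?_
      beta_reduce
      rw [show t - τ + (s + τ) = t + s by ring, show 2 * τ - (s + τ) = τ - s by ring, expL_F_fst (hcomp _ (hmem s hs))]
      simp only [hgm s hs]
    · simp only [hg0]; ring
  · ext x
    have e : sec W.2 x = (∫ σ in (0:ℝ)..(2 * τ), (expL (2 * τ - σ) (Fnl f (U (t - τ + σ)))).2 (fun _ => x))
        - 2 * τ * (expL τ (Fnl f (U t))).2 (fun _ => x) := by
      rw [hW, add_sub_cancel_left]; rfl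
    rw [e, shift, expL_F_snd (hcomp t m0)]
    unfold D2
    rw [intervalIntegral.integral_sub (Continuous.intervalIntegrable (by fun_prop) _ _) (continuous_const.intervalIntegrable _ _),
      intervalIntegral.integral_const, smul_eq_mul]
    congr 1
    · refine intervalIntegral.integral_congr fun s hs => ?_
      beta_reduce
      rw [show t - τ + (s + τ) = t + s by ring, show 2 * τ - (s + τ) = τ - s by ring, expL_F_snd (hcomp _ (hmem s hs))]
      simp only [hgm s hs]
    · simp only [hg0]; ring


/-- **Local truncation error of sLRI1 (3.44).**
Let `0 ≤ r < 1` and suppose the mild solution satisfies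
`U ∈ L^∞(0,T; H^{1+r}(𝕋) × H^r(𝕋))`.  Define the one-step defect
`𝓡_τ(tₙ) := U(t_{n+1}) - e^{2τL} U(t_{n-1}) - 2τ e^{τL} F(U(tₙ))`.  Then
`‖𝓡_τ(tₙ)‖₁ ≤ C(sup_t ‖U(·,t)‖_{1+r}) τ^{2+r}`, where `C` is independent of
`τ` and `n`. -/
theorem sLRI1_local_error
    (f : ℝ → ℝ) (L : ℝ) (hf : ContDiff ℝ 2 f)
    (hf1 : ∀ x : ℝ, |deriv f x| ≤ L) (hf2 : ∀ x : ℝ, |deriv (deriv f) x| ≤ L)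
    (T : ℝ) (hT : 0 < T) (r : ℝ) (hr0 : 0 ≤ r) (hr1 : r < 1)
    (U : ℝ → Pair 1) (hmild : IsMild f T U)
    (hreg : ∀ t ∈ Set.Icc (0:ℝ) T, PMem (1+r) (U t))
    (hbdd : ∃ B : ℝ, ∀ t ∈ Set.Icc (0:ℝ) T, pnorm (1+r) (U t) ≤ B) :
    ∃ C > 0, ∀ τ : ℝ, 0 < τ → ∀ n : ℕ, 1 ≤ n → ((n : ℝ) + 1) * τ ≤ T →
      pnorm 1 (U (((n : ℝ) + 1) * τ)
          - expL (2*τ) (U (((n : ℝ) - 1) * τ))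
          - (2*τ) • expL τ (Fnl f (U ((n : ℝ) * τ))))
        ≤ C * τ ^ (2 + r) := by
  obtain ⟨B, hB⟩ := hbdd
  have hF := fok_of hf hf1 hf2
  have hL : 0 ≤ L := (abs_nonneg _).trans (hf1 0)
  have hwave := mild_wave hF hr0 hmild hreg hB
  have hM0 : 0 ≤ |f 0| + L * (ZZ + B ^ 2) := by have := ZZ_nonneg; positivity
  obtain ⟨K, hK, hcore⟩ := wave_core hwave (sq_nonneg B) hM0 hT.le hr0 hr1.le (θ := (1 + 3 * r) / 4)
    (by linarith) (by linarith) (by linarith)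
  have hcomp : ∀ t ∈ Icc (0:ℝ) T, Nice (fun x => f (sec (U t).1 x)) := fun t ht =>
    comp_nice (hwave.cu t ht) (hwave.pu t ht) ((hwave.hu t ht).mono (by linarith)) hF.lip hF.cont
  have hC := C2_nonneg (L := L) (r := r) (θ := (1 + 3 * r) / 4) hK hT.le
  refine ⟨Real.sqrt (C2 L K T r ((1 + 3 * r) / 4)) + 1, by positivity, ?_⟩
  intro τ hτ n hn hnT
  have hn' : (1:ℝ) ≤ n := by exact_mod_cast hn
  have e1 : ((n:ℝ) + 1) * τ = n * τ + τ := by ring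
  have e2 : ((n:ℝ) - 1) * τ = n * τ - τ := by ring
  rw [e1] at hnT ⊢
  rw [e2]
  have h1 : 0 ≤ (n:ℝ) * τ - τ := by nlinarith
  obtain ⟨d1, d2⟩ := defect_eq hF hT.le hmild hcomp hcore (by linarith) h1 hτ hnT _ rfl
  have hc := core_concl hcore hF (by linarith) hr0 (by linarith) hK h1 hτ hnT
  unfold pnorm
  rw [sub_self, sob_sq, sob_sq, d1, d2]
  have ep : τ ^ 2 * (τ ^ 2 * τ ^ (2 * r)) = (τ ^ (2 + r)) ^ 2 := by
    rw [← Real.rpow_natCast (τ ^ (2 + r)), ← Real.rpow_mul hτ.le,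
      show (2 + r) * ((2:ℕ):ℝ) = 2 + (2 + 2 * r) by push_cast; ring,
      Real.rpow_add hτ, Real.rpow_add hτ]
    norm_num
  rw [ep] at hc
  refine (Real.sqrt_le_sqrt hc).trans ?_
  have hp : 0 ≤ τ ^ (2 + r) := Real.rpow_nonneg hτ.le _
  rw [Real.sqrt_mul hC, Real.sqrt_sq hp]
  gcongr
  linarith

end KG
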